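/- Let p ≥ 2, α = p−1 and θ ≥ 0, and let 0 < μ < μ_{α,θ}. Then the subcritical supremum TMSC(μ,α,θ) is attained: there exists u ∈ X with u ≠ 0 and ‖u′‖_{L^p_α} ≤ 1 such that TMSC(μ,α,θ) = ‖u‖_{L^p_θ}^{-p} ∫₀^∞ φ_p(μ|u|^{p/(p−1)}) dλ_θ. -/

import Mathlib

open MeasureTheory Real Filter ENNReal

/-- The fractional-dimension spherical volume constant `ω_θ = 2π^((θ+1)/2)/Γ((θ+1)/2)`. -/
noncomputable def omegaW (θ : ℝ) : ℝ := 2 * Real.pi ^ ((θ + 1) / 2) / Real.Gamma ((θ + 1) / 2)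

/-- Weighted integral `∫₀^∞ f dλ_θ = ω_θ ∫₀^∞ f(r) r^θ dr` (for nonnegative integrands,
valued in `ℝ≥0∞`). -/
noncomputable def wInt (θ : ℝ) (f : ℝ → ℝ) : ℝ≥0∞ :=
  ENNReal.ofReal (omegaW θ) *
    ∫⁻ r in Set.Ioi (0 : ℝ), ENNReal.ofReal (f r) * ENNReal.ofReal (r ^ θ)

/-- The weighted Lebesgue norm `‖u‖_{L^q_θ}` (valued in `ℝ≥0∞`). -/
noncomputable def wNorm (θ q : ℝ) (u : ℝ → ℝ) : ℝ≥0∞ :=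
  (wInt θ fun r => |u r| ^ q) ^ (1 / q)

/-- Membership in the weighted Sobolev space `X = X^{1,p}_∞(α,θ)`:
`u` is locally absolutely continuous on `(0,∞)` with a.e. derivative `u'`
(expressed through the fundamental theorem of calculus on compact subintervals),
`u(r) → 0` as `r → ∞`, `‖u‖_{L^p_θ} < ∞` and `‖u'‖_{L^p_α} < ∞`. -/
structure MemX (p α θ : ℝ) (u u' : ℝ → ℝ) : Prop where
  ftc_int : ∀ a b : ℝ, 0 < a → a ≤ b → IntervalIntegrable u' MeasureTheory.volume a b
  ftc : ∀ a b : ℝ, 0 < a → a ≤ b → u b - u a = ∫ t in a..b, u' t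
  lim_zero : Filter.Tendsto u Filter.atTop (nhds 0)
  fin_u : wNorm θ p u < ⊤
  fin_u' : wNorm α p u' < ⊤

/-- Full norm on `X`: `‖u‖ = (‖u‖_{L^p_θ}^p + ‖u'‖_{L^p_α}^p)^{1/p}`. -/
noncomputable def Xnorm (p α θ : ℝ) (u u' : ℝ → ℝ) : ℝ≥0∞ :=
  ((wNorm θ p u) ^ p + (wNorm α p u') ^ p) ^ (1 / p)

/-- The truncated exponential `φ_p(t) = Σ_{j ∈ ℕ, j ≥ p-1} t^j / j!`. -/
noncomputable def phiP (p t : ℝ) : ℝ :=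
  ∑' j : ℕ, if p - 1 ≤ (j : ℝ) then t ^ j / (Nat.factorial j : ℝ) else 0

/-- The critical constant `μ_{α,θ} = (θ+1) ω_α^{1/α}`. -/
noncomputable def muC (α θ : ℝ) : ℝ := (θ + 1) * (omegaW α) ^ (1 / α)

/-- The Trudinger–Moser functional `∫₀^∞ φ_p(μ |u|^{p/(p-1)}) dλ_θ`. -/
noncomputable def TMfunc (p θ μ : ℝ) (u : ℝ → ℝ) : ℝ≥0∞ :=
  wInt θ fun r => phiP p (μ * |u r| ^ (p / (p - 1)))

/-- The subcritical Trudinger–Moser supremum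
`TMSC(μ,α,θ) = sup { ‖u‖_{L^p_θ}^{-p} ∫₀^∞ φ_p(μ|u|^{p/(p-1)}) dλ_θ : u ∈ X, u ≠ 0, ‖u'‖_{L^p_α} ≤ 1 }`. -/
noncomputable def TMSC (p α θ μ : ℝ) : ℝ≥0∞ :=
  ⨆ (u : ℝ → ℝ) (u' : ℝ → ℝ) (_ : MemX p α θ u u') (_ : u ≠ 0)
    (_ : wNorm α p u' ≤ 1), (wNorm θ p u) ^ (-p) * TMfunc p θ μ u

/-- The critical Trudinger–Moser supremum
`TMC(σ,α,θ) = sup { ∫₀^∞ φ_p(σ|u|^{p/(p-1)}) dλ_θ : u ∈ X, ‖u‖ ≤ 1 }`. -/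
noncomputable def TMC (p α θ σ : ℝ) : ℝ≥0∞ :=
  ⨆ (u : ℝ → ℝ) (u' : ℝ → ℝ) (_ : MemX p α θ u u') (_ : Xnorm p α θ u u' ≤ 1),
    TMfunc p θ σ u

/-- `k₀ = min { j ∈ ℕ : j ≥ p - 1 }`. -/
noncomputable def k0 (p : ℝ) : ℕ := sInf {j : ℕ | p - 1 ≤ (j : ℝ)}

/-- `TMC(σ,α,θ)` is attained by some `u ∈ X` with `‖u‖ ≤ 1`. -/
def TMCAttained (p α θ σ : ℝ) : Prop :=
  ∃ u u' : ℝ → ℝ, MemX p α θ u u' ∧ Xnorm p α θ u u' ≤ 1 ∧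
    TMC p α θ σ = TMfunc p θ σ u

/-- `σ_* = inf { σ ∈ (0, μ_{α,θ}) : TMC(σ,α,θ) is attained }`. -/
noncomputable def sigmaStar (p α θ : ℝ) : ℝ :=
  sInf {σ : ℝ | σ ∈ Set.Ioo 0 (muC α θ) ∧ TMCAttained p α θ σ}

/-- The weighted integral `∫₀^∞ f(r) r^θ dr` without the normalising constant. -/
noncomputable def radialInt (θ : ℝ) (f : ℝ → ℝ) : ℝ≥0∞ :=
  ∫⁻ r in Set.Ioi (0 : ℝ), ENNReal.ofReal (f r) * ENNReal.ofReal (r ^ θ)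

/-- `u` is locally absolutely continuous on `(0,∞)` with derivative `u'`, vanishes at infinity,
and satisfies the energy bound `M` and the mass bound `L`. -/
structure Adm (p θ M L : ℝ) (u u' : ℝ → ℝ) : Prop where
  ftc_int : ∀ a b : ℝ, 0 < a → a ≤ b → IntervalIntegrable u' volume a b
  ftc : ∀ a b : ℝ, 0 < a → a ≤ b → u b - u a = ∫ t in a..b, u' t
  lim_zero : Tendsto u atTop (nhds 0)
  energy : radialInt (p - 1) (fun r => |u' r| ^ p) ≤ ENNReal.ofReal M
  mass : radialInt θ (fun r => |u r| ^ p) ≤ ENNReal.ofReal L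

lemma aemeasurable_Ioi_of_intervalIntegrable {v : ℝ → ℝ}
    (h : ∀ a b : ℝ, 0 < a → a ≤ b → IntervalIntegrable v volume a b) :
    AEMeasurable v (volume.restrict (Set.Ioi 0)) := by
  have hU : Set.Ioi (0 : ℝ) = ⋃ n : ℕ, Set.Ioc (1 / ((n : ℝ) + 1)) ((n : ℝ) + 1) := by
    ext x
    simp only [Set.mem_Ioi, Set.mem_iUnion, Set.mem_Ioc]
    constructor
    · intro hx
      obtain ⟨n, hn⟩ := exists_nat_one_div_lt hx
      obtain ⟨m, hm⟩ := exists_nat_ge x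
      refine ⟨max n m, lt_of_le_of_lt ?_ hn, hm.trans ?_⟩
      · apply one_div_le_one_div_of_le (by positivity)
        have : (n : ℝ) ≤ ((max n m : ℕ) : ℝ) := by exact_mod_cast le_max_left n m
        linarith
      · have : (m : ℝ) ≤ ((max n m : ℕ) : ℝ) := by exact_mod_cast le_max_right n m
        linarith
    · rintro ⟨n, hn, -⟩
      exact lt_trans (by positivity) hn
  rw [hU, aemeasurable_iUnion_iff]
  intro n
  have h1 : (1 : ℝ) / ((n : ℝ) + 1) ≤ (n : ℝ) + 1 := by
    rw [div_le_iff₀ (by positivity)]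
    have : (0 : ℝ) ≤ n := n.cast_nonneg
    nlinarith
  exact ((intervalIntegrable_iff_integrableOn_Ioc_of_le h1).1
    (h _ _ (by positivity) h1)).aestronglyMeasurable.aemeasurable

lemma lintegral_enorm_le_energy {p : ℝ} (hp : 1 < p) {v : ℝ → ℝ} {S : Set ℝ}
    (hS : MeasurableSet S) (hS0 : S ⊆ Set.Ioi 0)
    (hv : AEMeasurable v (volume.restrict (Set.Ioi 0))) :
    ∫⁻ r in S, ‖v r‖ₑ ≤
      (∫⁻ r in S, ENNReal.ofReal (|v r| ^ p) * ENNReal.ofReal (r ^ (p - 1))) ^ (1 / p) *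
        (∫⁻ r in S, ENNReal.ofReal r⁻¹) ^ ((p - 1) / p) := by
  have hp0 : 0 < p := by linarith
  have hq : p.HolderConjugate (p / (p - 1)) := Real.HolderConjugate.conjExponent hp
  have hvS : AEMeasurable v (volume.restrict S) := hv.mono_measure (Measure.restrict_mono hS0 le_rfl)
  have key := ENNReal.lintegral_mul_le_Lp_mul_Lq (volume.restrict S) hq
    (f := fun r => ‖v r‖ₑ * ENNReal.ofReal (r ^ ((p - 1) / p)))
    (g := fun r => ENNReal.ofReal (r ^ (-((p - 1) / p))))
    (hvS.enorm.mul (by fun_prop)) (by fun_prop)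
  have hpp : 1 / (p / (p - 1)) = (p - 1) / p := by rw [one_div_div]
  rw [hpp] at key
  have e0 : ∫⁻ r in S, ‖v r‖ₑ = ∫⁻ r in S, ((fun r => ‖v r‖ₑ * ENNReal.ofReal (r ^ ((p - 1) / p))) *
      (fun r => ENNReal.ofReal (r ^ (-((p - 1) / p))))) r := by
    refine setLIntegral_congr_fun hS fun r hr => ?_
    have hr0 : (0 : ℝ) < r := hS0 hr
    simp only [Pi.mul_apply]
    rw [mul_assoc, ← ENNReal.ofReal_mul (by positivity), ← Real.rpow_add hr0]
    simp
  have e1 : ∫⁻ r in S, ENNReal.ofReal (|v r| ^ p) * ENNReal.ofReal (r ^ (p - 1)) =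
      ∫⁻ r in S, (‖v r‖ₑ * ENNReal.ofReal (r ^ ((p - 1) / p))) ^ p := by
    refine setLIntegral_congr_fun hS fun r hr => ?_
    have hr0 : (0 : ℝ) < r := hS0 hr
    rw [ENNReal.mul_rpow_of_nonneg _ _ hp0.le, ENNReal.ofReal_rpow_of_nonneg (by positivity) hp0.le,
      ← Real.rpow_mul hr0.le, div_mul_cancel₀ _ hp0.ne', Real.enorm_eq_ofReal_abs,
      ENNReal.ofReal_rpow_of_nonneg (abs_nonneg _) hp0.le]
  have e2 : ∫⁻ r in S, ENNReal.ofReal r⁻¹ =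
      ∫⁻ r in S, (ENNReal.ofReal (r ^ (-((p - 1) / p)))) ^ (p / (p - 1)) := by
    refine setLIntegral_congr_fun hS fun r hr => ?_
    have hr0 : (0 : ℝ) < r := hS0 hr
    have h1 : 0 < p - 1 := by linarith
    rw [ENNReal.ofReal_rpow_of_nonneg (by positivity) (by positivity), ← Real.rpow_mul hr0.le]
    have : -((p - 1) / p) * (p / (p - 1)) = -1 := by field_simp
    rw [this, Real.rpow_neg_one]
  rw [e0, e1, e2]
  exact key

lemma lintegral_inv_Ioc {a b : ℝ} (ha : 0 < a) (hab : a ≤ b) :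
    ∫⁻ r in Set.Ioc a b, ENNReal.ofReal r⁻¹ = ENNReal.ofReal (Real.log (b / a)) := by
  have hint : IntervalIntegrable (fun r : ℝ => r⁻¹) volume a b := by
    apply intervalIntegral.intervalIntegrable_inv
    · intro x hx
      rw [Set.uIcc_of_le hab] at hx
      exact (lt_of_lt_of_le ha hx.1).ne'
    · fun_prop
  rw [← integral_inv_of_pos ha (ha.trans_le hab), intervalIntegral.integral_of_le hab,
    ofReal_integral_eq_lintegral_ofReal]
  · exact (intervalIntegrable_iff_integrableOn_Ioc_of_le hab).1 hint
  · filter_upwards [ae_restrict_mem measurableSet_Ioc] with x hx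
    exact inv_nonneg.2 (ha.trans hx.1).le

namespace Adm

variable {p θ M L : ℝ} {u u' : ℝ → ℝ}

lemma aemeasurable_deriv (h : Adm p θ M L u u') :
    AEMeasurable u' (volume.restrict (Set.Ioi 0)) :=
  aemeasurable_Ioi_of_intervalIntegrable h.ftc_int

lemma ofReal_abs_sub_le (h : Adm p θ M L u u') {a b : ℝ} (ha : 0 < a) (hab : a ≤ b) :
    ENNReal.ofReal |u b - u a| ≤ ∫⁻ r in Set.Ioc a b, ‖u' r‖ₑ := by
  rw [h.ftc a b ha hab, ← Real.enorm_eq_ofReal_abs, intervalIntegral.integral_of_le hab]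
  exact enorm_integral_le_lintegral_enorm _

lemma rpow_abs_sub_le (hp : 1 < p) (h : Adm p θ M L u u') {a b : ℝ} (ha : 0 < a) (hab : a ≤ b) :
    ENNReal.ofReal (|u b - u a| ^ p) ≤
      (∫⁻ r in Set.Ioc a b, ENNReal.ofReal (|u' r| ^ p) * ENNReal.ofReal (r ^ (p - 1))) *
        ENNReal.ofReal (Real.log (b / a)) ^ (p - 1) := by
  have hp0 : 0 < p := by linarith
  have h1 := (h.ofReal_abs_sub_le ha hab).trans (lintegral_enorm_le_energy hp measurableSet_Ioc
    (fun x hx => ha.trans hx.1) h.aemeasurable_deriv)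
  rw [lintegral_inv_Ioc ha hab] at h1
  have h2 := ENNReal.rpow_le_rpow h1 hp0.le
  rw [ENNReal.ofReal_rpow_of_nonneg (abs_nonneg _) hp0.le, ENNReal.mul_rpow_of_nonneg _ _ hp0.le,
    ← ENNReal.rpow_mul, ← ENNReal.rpow_mul, div_mul_cancel₀ _ hp0.ne', div_mul_cancel₀ _ hp0.ne',
    ENNReal.rpow_one] at h2
  exact h2

lemma abs_sub_le (hp : 1 < p) (hM : 0 ≤ M) (h : Adm p θ M L u u') {a b : ℝ} (ha : 0 < a)
    (hab : a ≤ b) : |u b - u a| ≤ M ^ (1 / p) * Real.log (b / a) ^ ((p - 1) / p) := by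
  have hp0 : 0 < p := by linarith
  have hlog : 0 ≤ Real.log (b / a) := Real.log_nonneg ((one_le_div ha).2 hab)
  have h1 := h.rpow_abs_sub_le hp ha hab
  have h2 : (∫⁻ r in Set.Ioc a b, ENNReal.ofReal (|u' r| ^ p) * ENNReal.ofReal (r ^ (p - 1))) ≤
      ENNReal.ofReal M :=
    (lintegral_mono_set (fun x hx => ha.trans hx.1)).trans h.energy
  have h3 := h1.trans (mul_le_mul_left h2 _)
  rw [ENNReal.ofReal_rpow_of_nonneg hlog (by linarith), ← ENNReal.ofReal_mul hM,
    ENNReal.ofReal_le_ofReal_iff (by positivity)] at h3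
  have h4 := Real.rpow_le_rpow (by positivity) h3 (by positivity : 0 ≤ 1 / p)
  rw [← Real.rpow_mul (abs_nonneg _), mul_one_div_cancel hp0.ne', Real.rpow_one,
    Real.mul_rpow hM (by positivity), ← Real.rpow_mul hlog, mul_one_div] at h4
  exact h4

lemma continuousOn (h : Adm p θ M L u u') :
    ContinuousOn u (Set.Ioi 0) := by
  intro x hx
  have hx : (0 : ℝ) < x := hx
  apply ContinuousAt.continuousWithinAt
  have hf : ContinuousOn (fun y => u (x / 2) + ∫ t in (x / 2)..y, u' t) (Set.uIcc (x / 2) (2 * x)) :=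
    continuousOn_const.add (intervalIntegral.continuousOn_primitive_interval
      ((intervalIntegrable_iff').1 (h.ftc_int _ _ (by linarith) (by linarith))))
  rw [Set.uIcc_of_le (by linarith)] at hf
  have h2 : ContinuousOn u (Set.Icc (x / 2) (2 * x)) :=
    hf.congr fun y hy => by linarith [h.ftc (x / 2) y (by linarith) hy.1]
  exact h2.continuousAt (Icc_mem_nhds (by linarith) (by linarith))

lemma aemeasurable (h : Adm p θ M L u u') :
    AEMeasurable u (volume.restrict (Set.Ioi 0)) :=
  h.continuousOn.aemeasurable measurableSet_Ioi

/-- Pointwise bound from the mass on `(a, b]` and the oscillation estimate. -/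
lemma abs_le (hp : 1 < p) (hM : 0 ≤ M) (hL : 0 ≤ L) (hθ : 0 ≤ θ) (h : Adm p θ M L u u') {a b : ℝ}
    (ha : 0 < a) (hab : a < b) :
    |u a| ≤ ((L + 1) / ((b - a) * a ^ θ)) ^ (1 / p) +
      M ^ (1 / p) * Real.log (b / a) ^ ((p - 1) / p) := by
  have hp0 : 0 < p := by linarith
  set W := (L + 1) / ((b - a) * a ^ θ) with hW
  have hba : 0 < b - a := sub_pos.2 hab
  have haθ : 0 < a ^ θ := Real.rpow_pos_of_pos ha _
  have hW0 : 0 < W := by positivity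
  obtain ⟨s, hs, hsW⟩ : ∃ s ∈ Set.Ioc a b, |u s| ^ p ≤ W := by
    by_contra! hcon
    have h1 : ∫⁻ _ in Set.Ioc a b, ENNReal.ofReal W * ENNReal.ofReal (a ^ θ) ≤ ENNReal.ofReal L := by
      refine le_trans ?_ ((lintegral_mono_set (fun x hx => ha.trans hx.1)).trans h.mass :
        ∫⁻ r in Set.Ioc a b, ENNReal.ofReal (|u r| ^ p) * ENNReal.ofReal (r ^ θ) ≤ _)
      refine setLIntegral_mono' measurableSet_Ioc fun r hr => ?_
      exact mul_le_mul' (ENNReal.ofReal_le_ofReal (hcon r hr).le)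
        (ENNReal.ofReal_le_ofReal (Real.rpow_le_rpow ha.le hr.1.le hθ))
    rw [setLIntegral_const, Real.volume_Ioc, ← ENNReal.ofReal_mul hW0.le,
      ← ENNReal.ofReal_mul (by positivity), ENNReal.ofReal_le_ofReal_iff hL] at h1
    have : W * a ^ θ * (b - a) = L + 1 := by rw [hW]; field_simp
    linarith
  have h2 : |u s| ≤ W ^ (1 / p) := by
    have h4 := Real.rpow_le_rpow (by positivity) hsW (by positivity : 0 ≤ 1 / p)
    rwa [← Real.rpow_mul (abs_nonneg _), mul_one_div_cancel hp0.ne', Real.rpow_one] at h4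
  have h3 := h.abs_sub_le hp hM ha hs.1.le
  have h4 : Real.log (s / a) ^ ((p - 1) / p) ≤ Real.log (b / a) ^ ((p - 1) / p) := by
    have hsa : 0 < s / a := div_pos (ha.trans hs.1) ha
    apply Real.rpow_le_rpow (Real.log_nonneg ((one_le_div ha).2 hs.1.le))
    · apply Real.log_le_log hsa
      gcongr
      exact hs.2
    · apply div_nonneg <;> linarith
  have h5 : M ^ (1 / p) * Real.log (s / a) ^ ((p - 1) / p) ≤
    M ^ (1 / p) * Real.log (b / a) ^ ((p - 1) / p) := by gcongr
  have h6 : |u a| ≤ |u s| + |u s - u a| := by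
    have := abs_sub_abs_le_abs_sub (u a) (u s)
    rw [abs_sub_comm] at this
    linarith
  linarith

end Adm

/-- Uniform decay at infinity of admissible functions. -/
lemma Adm.uniform_decay {p θ M L : ℝ} (hp : 1 < p) (hM : 0 ≤ M) (hL : 0 ≤ L) (hθ : 0 ≤ θ) {ε : ℝ}
    (hε : 0 < ε) : ∃ R : ℝ, 0 < R ∧ ∀ u u' : ℝ → ℝ, Adm p θ M L u u' → ∀ r, R ≤ r → |u r| ≤ ε := by
  have hp0 : 0 < p := by linarith
  have t1 : Tendsto (fun δ : ℝ => M ^ (1 / p) * Real.log (1 + δ) ^ ((p - 1) / p))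
      (nhdsWithin 0 (Set.Ioi 0)) (nhds 0) := by
    have c : ContinuousAt (fun δ : ℝ => M ^ (1 / p) * Real.log (1 + δ) ^ ((p - 1) / p)) 0 := by
      have c1 : ContinuousAt (fun δ : ℝ => Real.log (1 + δ)) 0 :=
        (by fun_prop : ContinuousAt (fun δ : ℝ => 1 + δ) 0).log (by norm_num)
      exact continuousAt_const.mul (c1.rpow_const (Or.inr (by
        apply div_nonneg <;> linarith)))
    have c2 := c.tendsto
    have : ((p - 1) / p) ≠ 0 := (div_pos (by linarith) hp0).ne'
    simp only [add_zero, Real.log_one, Real.zero_rpow this, mul_zero] at c2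
    exact c2.mono_left nhdsWithin_le_nhds
  obtain ⟨δ, hδ1, hδ0⟩ := ((t1.eventually (gt_mem_nhds (half_pos hε))).and
    self_mem_nhdsWithin).exists
  have hδ0 : 0 < δ := hδ0
  have t2 : Tendsto (fun a : ℝ => ((L + 1) / δ * (a ^ (θ + 1))⁻¹) ^ (1 / p)) atTop (nhds 0) := by
    have c1 : Tendsto (fun a : ℝ => (L + 1) / δ * (a ^ (θ + 1))⁻¹) atTop (nhds 0) := by
      simpa using ((tendsto_rpow_atTop (by linarith : 0 < θ + 1)).inv_tendsto_atTop.const_mul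
        ((L + 1) / δ))
    have c2 := c1.rpow_const (p := 1 / p) (Or.inr (by positivity))
    rwa [Real.zero_rpow (by positivity)] at c2
  obtain ⟨R, hR⟩ := eventually_atTop.1 (t2.eventually (gt_mem_nhds (half_pos hε)))
  refine ⟨max R 1, by positivity, fun u u' h r hr => ?_⟩
  have hr1 : 1 ≤ r := (le_max_right _ _).trans hr
  have hr0 : 0 < r := by linarith
  have h1 := h.abs_le hp hM hL hθ hr0 (b := (1 + δ) * r) (by nlinarith)
  have h2 := hR r ((le_max_left _ _).trans hr)
  have e1 : (1 + δ) * r / r = 1 + δ := by field_simp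
  have e2 : (L + 1) / (((1 + δ) * r - r) * r ^ θ) = (L + 1) / δ * (r ^ (θ + 1))⁻¹ := by
    rw [Real.rpow_add hr0, Real.rpow_one, show (1 + δ) * r - r = δ * r by ring]
    have := Real.rpow_pos_of_pos hr0 θ
    field_simp
  rw [e1, e2] at h1
  linarith

lemma tendsto_log_rpow_zero {p M a : ℝ} (hp : 1 < p) (ha : 0 < a) :
    Tendsto (fun b : ℝ => M ^ (1 / p) * Real.log (b / a) ^ ((p - 1) / p)) (nhds a) (nhds 0) := by
  have hpp : 0 < (p - 1) / p := div_pos (by linarith) (by linarith)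
  have c1 : ContinuousAt (fun b : ℝ => Real.log (b / a)) a :=
    (by fun_prop : ContinuousAt (fun b : ℝ => b / a) a).log (by rw [div_self ha.ne']; norm_num)
  have c : ContinuousAt (fun b : ℝ => M ^ (1 / p) * Real.log (b / a) ^ ((p - 1) / p)) a :=
    continuousAt_const.mul (c1.rpow_const (Or.inr hpp.le))
  have c2 := c.tendsto
  simpa [div_self ha.ne', Real.zero_rpow hpp.ne'] using c2

/-- Pointwise sequential compactness of admissible functions. -/
lemma Adm.exists_subseq {p θ M L : ℝ} (hp : 1 < p) (hM : 0 ≤ M) (hL : 0 ≤ L) (hθ : 0 ≤ θ)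
    {u u' : ℕ → ℝ → ℝ} (h : ∀ n, Adm p θ M L (u n) (u' n)) :
    ∃ φ : ℕ → ℕ, StrictMono φ ∧ ∃ w : ℝ → ℝ,
      ∀ r, 0 < r → Tendsto (fun n => u (φ n) r) atTop (nhds (w r)) := by
  set B : ℝ → ℝ := fun a => ((L + 1) / ((2 * a - a) * a ^ θ)) ^ (1 / p) +
      M ^ (1 / p) * Real.log (2 * a / a) ^ ((p - 1) / p) with hB
  have hub : ∀ n a, 0 < a → |u n a| ≤ B a := fun n a ha =>
    (h n).abs_le hp hM hL hθ ha (by linarith)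
  have hcomp : IsCompact (Set.pi Set.univ (fun q : {q : ℚ // 0 < q} =>
      Set.Icc (-B (q.1 : ℝ)) (B (q.1 : ℝ)))) := isCompact_univ_pi fun _ => isCompact_Icc
  obtain ⟨l, -, φ, hφ, hl⟩ := hcomp.tendsto_subseq
    (x := fun n (q : {q : ℚ // 0 < q}) => u n (q.1 : ℝ))
    (fun n q _ => _root_.abs_le.1 (hub n _ (by exact_mod_cast q.2)))
  rw [tendsto_pi_nhds] at hl
  have hC : ∀ r, 0 < r → ∃ w, Tendsto (fun n => u (φ n) r) atTop (nhds w) := by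
    intro r hr
    apply cauchySeq_tendsto_of_complete
    rw [Metric.cauchySeq_iff]
    intro ε hε
    have ev := (tendsto_log_rpow_zero (M := M) hp hr).eventually
      (gt_mem_nhds (by positivity : 0 < ε / 3))
    obtain ⟨η, hη, hball⟩ := Metric.eventually_nhds_iff.1 ev
    obtain ⟨q, hq1, hq2⟩ := exists_rat_btwn (by linarith : r < r + η)
    have hq0 : (0 : ℚ) < q := by exact_mod_cast hr.trans hq1
    have hosc : M ^ (1 / p) * Real.log (q / r) ^ ((p - 1) / p) < ε / 3 :=
      hball (by rw [Real.dist_eq, abs_of_pos] <;> linarith)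
    have hcq := Metric.cauchySeq_iff.1 (hl ⟨q, hq0⟩).cauchySeq (ε / 3) (by positivity)
    obtain ⟨N, hN⟩ := hcq
    refine ⟨N, fun m hm n hn => ?_⟩
    have h1 := hN m hm n hn
    simp only [Function.comp_apply, Real.dist_eq] at h1 ⊢
    have h2 := (h (φ m)).abs_sub_le hp hM hr hq1.le
    have h3 := (h (φ n)).abs_sub_le hp hM hr hq1.le
    rw [_root_.abs_le] at h2 h3
    rw [abs_lt] at h1 ⊢
    constructor <;> linarith
  choose! w hw using hC
  exact ⟨φ, hφ, w, hw⟩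

section Limit

variable {p θ M L : ℝ} {u u' : ℕ → ℝ → ℝ} {w : ℝ → ℝ}

open AbsolutelyContinuousOnInterval in
lemma Adm.sum_edist_le (hp : 1 < p) {v v' : ℝ → ℝ} (h : Adm p θ M L v v') {a b : ℝ}
    (ha : 0 < a) (hab : a ≤ b) {E : ℕ × (ℕ → ℝ × ℝ)} (hE : E ∈ disjWithin a b) :
    ∑ i ∈ Finset.range E.1, edist (v (E.2 i).1) (v (E.2 i).2) ≤
      ENNReal.ofReal M ^ (1 / p) * (volume (⋃ i ∈ Finset.range E.1, Set.uIoc (E.2 i).1 (E.2 i).2) *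
        ENNReal.ofReal a⁻¹) ^ ((p - 1) / p) := by
  obtain ⟨n, I⟩ := E
  have hsub := biUnion_uIoc_subset_of_mem_disjWithin hE
  obtain ⟨h1, h2⟩ := hE
  simp only [] at h1 h2 hsub ⊢
  set S := ⋃ i ∈ Finset.range n, Set.uIoc (I i).1 (I i).2 with hS
  have hSm : MeasurableSet S := Finset.measurableSet_biUnion _ fun i _ => measurableSet_uIoc
  have hSa : ∀ x ∈ S, a < x := fun x hx => by
    have := hsub hx
    rw [Set.uIoc_of_le hab] at this
    exact this.1
  have hone : ∀ i ∈ Finset.range n, edist (v (I i).1) (v (I i).2) ≤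
      ∫⁻ r in Set.uIoc (I i).1 (I i).2, ‖v' r‖ₑ := by
    intro i hi
    obtain ⟨hx, hy⟩ := h1 i hi
    rw [Set.uIcc_of_le hab] at hx hy
    rcases le_total (I i).1 (I i).2 with hle | hle
    · rw [Set.uIoc_of_le hle, edist_comm, edist_dist, Real.dist_eq]
      exact h.ofReal_abs_sub_le (ha.trans_le hx.1) hle
    · rw [Set.uIoc_of_ge hle, edist_dist, Real.dist_eq]
      exact h.ofReal_abs_sub_le (ha.trans_le hy.1) hle
  calc ∑ i ∈ Finset.range n, edist (v (I i).1) (v (I i).2)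
      ≤ ∑ i ∈ Finset.range n, ∫⁻ r in Set.uIoc (I i).1 (I i).2, ‖v' r‖ₑ := Finset.sum_le_sum hone
    _ = ∫⁻ r in S, ‖v' r‖ₑ := by
        rw [hS, lintegral_biUnion_finset h2 (fun i _ => measurableSet_uIoc)]
    _ ≤ _ := lintegral_enorm_le_energy hp hSm (fun x hx => ha.trans (hSa x hx)) h.aemeasurable_deriv
    _ ≤ _ := by
        refine mul_le_mul' (ENNReal.rpow_le_rpow ?_ ?_) (ENNReal.rpow_le_rpow ?_ ?_)
        · exact (lintegral_mono_set fun x hx => ha.trans (hSa x hx)).trans h.energy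
        · exact div_nonneg zero_le_one (by linarith)
        · calc ∫⁻ r in S, ENNReal.ofReal r⁻¹ ≤ ∫⁻ _ in S, ENNReal.ofReal a⁻¹ :=
              setLIntegral_mono' hSm fun x hx => ENNReal.ofReal_le_ofReal
                (inv_anti₀ ha (hSa x hx).le)
            _ = _ := by rw [setLIntegral_const, mul_comm]
        · exact div_nonneg (by linarith) (by linarith)

open AbsolutelyContinuousOnInterval in
/-- A pointwise limit of admissible functions is locally absolutely continuous. -/
lemma Adm.absolutelyContinuous_of_tendsto (hp : 1 < p)
    (h : ∀ n, Adm p θ M L (u n) (u' n))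
    (hw : ∀ r, 0 < r → Tendsto (fun n => u n r) atTop (nhds (w r))) {a b : ℝ} (ha : 0 < a)
    (hab : a ≤ b) : AbsolutelyContinuousOnInterval w a b := by
  have hpp : 0 < (p - 1) / p := div_pos (by linarith) (by linarith)
  set G : ℕ × (ℕ → ℝ × ℝ) → ℝ≥0∞ := fun E => ENNReal.ofReal M ^ (1 / p) *
    (volume (⋃ i ∈ Finset.range E.1, Set.uIoc (E.2 i).1 (E.2 i).2) *
        ENNReal.ofReal a⁻¹) ^ ((p - 1) / p) with hG
  have hGt : Tendsto G (totalLengthFilter ⊓ 𝓟 (disjWithin a b)) (nhds 0) := by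
    have h1 := tendsto_volume_totalLengthFilter_nhds_zero.mono_left
      (inf_le_left : totalLengthFilter ⊓ 𝓟 (disjWithin a b) ≤ _)
    have h2 := (ENNReal.Tendsto.mul_const h1 (Or.inr ENNReal.ofReal_ne_top) :
      Tendsto _ _ (nhds (0 * ENNReal.ofReal a⁻¹)))
    have h3 := (ENNReal.continuous_rpow_const (y := (p - 1) / p)).continuousAt.tendsto.comp h2
    have h4 := ENNReal.Tendsto.const_mul (a := ENNReal.ofReal M ^ (1 / p)) h3
      (Or.inr (ENNReal.rpow_ne_top_of_nonneg (by positivity) ENNReal.ofReal_ne_top))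
    simpa [ENNReal.zero_rpow_of_pos hpp, hG] using h4
  have hle : ∀ E ∈ disjWithin a b,
      ∑ i ∈ Finset.range E.1, edist (w (E.2 i).1) (w (E.2 i).2) ≤ G E := by
    intro E hE
    refine le_of_tendsto' (x := atTop) (f := fun n => ∑ i ∈ Finset.range E.1,
      edist (u n (E.2 i).1) (u n (E.2 i).2)) (tendsto_finsetSum _ fun i hi => ?_)
      fun n => (h n).sum_edist_le hp ha hab hE
    obtain ⟨hx, hy⟩ := hE.1 i hi
    rw [Set.uIcc_of_le hab] at hx hy
    exact (hw _ (ha.trans_le hx.1)).edist (hw _ (ha.trans_le hy.1))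
  have hT : Tendsto (fun E : ℕ × (ℕ → ℝ × ℝ) => ∑ i ∈ Finset.range E.1,
      edist (w (E.2 i).1) (w (E.2 i).2)) (totalLengthFilter ⊓ 𝓟 (disjWithin a b)) (nhds 0) :=
    tendsto_of_tendsto_of_tendsto_of_le_of_le' tendsto_const_nhds hGt
      (Eventually.of_forall fun _ => zero_le) (eventually_inf_principal.2
        (Eventually.of_forall hle))
  have := (ENNReal.tendsto_toReal ENNReal.zero_ne_top).comp hT
  refine this.congr fun E => ?_
  simp only [Function.comp_apply]
  rw [ENNReal.toReal_sum fun i _ => edist_ne_top _ _]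
  simp [edist_dist, ENNReal.toReal_ofReal]

end Limit

lemma Adm.lintegral_quotient_le {p θ M L : ℝ} (hp : 1 < p) {v v' : ℝ → ℝ}
    (h : Adm p θ M L v v') {l : ℝ} (hl : 1 < l) :
    ∫⁻ t in Set.Ioi (0 : ℝ), ENNReal.ofReal (|v (l * t) - v t| ^ p) * ENNReal.ofReal t⁻¹ ≤
      ENNReal.ofReal (Real.log l) ^ p * ENNReal.ofReal M := by
  have hl0 : 0 < l := by linarith
  have hlog : 0 < Real.log l := Real.log_pos hl
  set c := ENNReal.ofReal (Real.log l) with hc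
  have hF : AEMeasurable (fun s => ENNReal.ofReal (|v' s| ^ p) * ENNReal.ofReal (s ^ (p - 1)))
      (volume.restrict (Set.Ioi 0)) := by
    have := h.aemeasurable_deriv
    exact ((this.abs.pow_const p).ennreal_ofReal).mul (by fun_prop)
  set F := hF.mk _ with hFdef
  have hFm : Measurable F := hF.measurable_mk
  have hFe : (fun s => ENNReal.ofReal (|v' s| ^ p) * ENNReal.ofReal (s ^ (p - 1)))
    =ᵐ[volume.restrict (Set.Ioi 0)] F := hF.ae_eq_mk
  set K : ℝ → ℝ → ℝ≥0∞ := fun t s => if t < s ∧ s ≤ l * t then F s * ENNReal.ofReal t⁻¹ else 0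
    with hK
  have hKm : Measurable (Function.uncurry K) := by
    apply Measurable.ite
    · exact (measurableSet_lt measurable_fst measurable_snd).inter
        (measurableSet_le measurable_snd (measurable_fst.const_mul l))
    · exact (hFm.comp measurable_snd).mul (measurable_fst.inv.ennreal_ofReal)
    · exact measurable_const
  have h1 : ∀ t ∈ Set.Ioi (0 : ℝ), ENNReal.ofReal (|v (l * t) - v t| ^ p) * ENNReal.ofReal t⁻¹ ≤
      c ^ (p - 1) * ∫⁻ s in Set.Ioi (0 : ℝ), K t s := by
    intro t ht
    have ht : 0 < t := ht
    have h2 := h.rpow_abs_sub_le hp ht (by nlinarith : t ≤ l * t)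
    rw [mul_div_cancel_right₀ _ ht.ne'] at h2
    have h3 : ∫⁻ r in Set.Ioc t (l * t), ENNReal.ofReal (|v' r| ^ p) * ENNReal.ofReal (r ^ (p - 1)) =
        ∫⁻ r in Set.Ioc t (l * t), F r :=
      lintegral_congr_ae (ae_restrict_of_ae_restrict_of_subset (fun x hx => ht.trans hx.1) hFe)
    have h4 : ∫⁻ s in Set.Ioi (0 : ℝ), K t s =
        (∫⁻ r in Set.Ioc t (l * t), F r) * ENNReal.ofReal t⁻¹ := by
      rw [← lintegral_mul_const _ hFm, ← lintegral_indicator measurableSet_Ioc,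
        ← lintegral_indicator measurableSet_Ioi]
      congr 1
      ext s
      by_cases hs : s ∈ Set.Ioc t (l * t)
      · have hs0 : s ∈ Set.Ioi (0 : ℝ) := ht.trans hs.1
        rw [Set.indicator_of_mem hs, Set.indicator_of_mem hs0]
        exact if_pos hs
      · rw [Set.indicator_of_notMem hs]
        by_cases hs0 : s ∈ Set.Ioi (0 : ℝ)
        · rw [Set.indicator_of_mem hs0]
          exact if_neg hs
        · rw [Set.indicator_of_notMem hs0]
    rw [h4, ← h3, ← mul_assoc]
    gcongr
    exact h2.trans_eq (mul_comm _ _)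
  calc _ ≤ ∫⁻ t in Set.Ioi (0 : ℝ), c ^ (p - 1) * ∫⁻ s in Set.Ioi (0 : ℝ), K t s :=
        setLIntegral_mono' measurableSet_Ioi h1
    _ = c ^ (p - 1) * ∫⁻ t in Set.Ioi (0 : ℝ), ∫⁻ s in Set.Ioi (0 : ℝ), K t s :=
        lintegral_const_mul' _ _ (ENNReal.rpow_ne_top_of_nonneg (by linarith) ENNReal.ofReal_ne_top)
    _ = c ^ (p - 1) * ∫⁻ s in Set.Ioi (0 : ℝ), ∫⁻ t in Set.Ioi (0 : ℝ), K t s := by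
        rw [lintegral_lintegral_swap hKm.aemeasurable]
    _ = c ^ (p - 1) * ∫⁻ s in Set.Ioi (0 : ℝ), F s * c := by
        congr 1
        refine setLIntegral_congr_fun measurableSet_Ioi fun s hs => ?_
        have hs : 0 < s := hs
        have hsl : 0 < s / l := by positivity
        have e : ∫⁻ t in Set.Ico (s / l) s, ENNReal.ofReal t⁻¹ = c := by
          rw [setLIntegral_congr Ico_ae_eq_Ioc, lintegral_inv_Ioc hsl
            (div_le_self hs.le hl.le), hc]
          congr 2
          field_simp
        rw [← e, ← lintegral_const_mul _ (by fun_prop), ← lintegral_indicator measurableSet_Ico,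
          ← lintegral_indicator measurableSet_Ioi]
        congr 1
        ext t
        by_cases ht : t ∈ Set.Ico (s / l) s
        · have ht0 : t ∈ Set.Ioi (0 : ℝ) := hsl.trans_le ht.1
          rw [Set.indicator_of_mem ht, Set.indicator_of_mem ht0]
          exact if_pos ⟨ht.2, by rw [mul_comm]; exact (div_le_iff₀ hl0).1 ht.1⟩
        · rw [Set.indicator_of_notMem ht]
          by_cases ht0 : t ∈ Set.Ioi (0 : ℝ)
          · rw [Set.indicator_of_mem ht0]
            exact if_neg fun hh => ht ⟨(div_le_iff₀ hl0).2 (by rw [mul_comm]; exact hh.2), hh.1⟩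
          · rw [Set.indicator_of_notMem ht0]
    _ = c ^ p * ∫⁻ s in Set.Ioi (0 : ℝ), F s := by
        rw [lintegral_mul_const _ hFm, mul_comm _ c, ← mul_assoc]
        congr 1
        have hc0 : c ≠ 0 := by simpa [hc] using hlog
        nth_rewrite 2 [← ENNReal.rpow_one c]
        rw [← ENNReal.rpow_add _ _ hc0 ENNReal.ofReal_ne_top]
        simp
    _ ≤ _ := by
        gcongr
        rw [← lintegral_congr_ae hFe]
        exact h.energy

section Limit

variable {p θ M L : ℝ} {u u' : ℕ → ℝ → ℝ} {w : ℝ → ℝ}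

lemma Adm.continuousOn_of_tendsto (hp : 1 < p)
    (h : ∀ n, Adm p θ M L (u n) (u' n))
    (hw : ∀ r, 0 < r → Tendsto (fun n => u n r) atTop (nhds (w r))) :
    ContinuousOn w (Set.Ioi 0) := by
  intro x hx
  have hx : (0 : ℝ) < x := hx
  have h1 := (Adm.absolutelyContinuous_of_tendsto hp h hw (a := x / 2) (b := 2 * x) (by linarith)
    (by linarith)).continuousOn
  rw [Set.uIcc_of_le (by linarith)] at h1
  exact (h1.continuousAt (Icc_mem_nhds (by linarith) (by linarith))).continuousWithinAt

lemma Adm.ae_differentiableAt_of_tendsto (hp : 1 < p)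
    (h : ∀ n, Adm p θ M L (u n) (u' n))
    (hw : ∀ r, 0 < r → Tendsto (fun n => u n r) atTop (nhds (w r))) :
    ∀ᵐ x ∂(volume.restrict (Set.Ioi 0)), DifferentiableAt ℝ w x := by
  rw [ae_restrict_iff' measurableSet_Ioi]
  have : ∀ n : ℕ, ∀ᵐ x : ℝ, x ∈ Set.uIcc (1 / ((n : ℝ) + 1)) ((n : ℝ) + 1) →
      DifferentiableAt ℝ w x := fun n => by
    refine (Adm.absolutelyContinuous_of_tendsto hp h hw (by positivity) ?_).ae_differentiableAt
    rw [div_le_iff₀ (by positivity)]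
    have : (0 : ℝ) ≤ n := n.cast_nonneg
    nlinarith
  filter_upwards [ae_all_iff.2 this] with x hx hx0
  obtain ⟨n, hn⟩ := exists_nat_one_div_lt (Set.mem_Ioi.1 hx0)
  obtain ⟨m, hm⟩ := exists_nat_ge x
  refine hx (max n m) (Set.Icc_subset_uIcc ⟨le_trans ?_ hn.le, hm.trans ?_⟩)
  · apply one_div_le_one_div_of_le (by positivity)
    have : (n : ℝ) ≤ ((max n m : ℕ) : ℝ) := by exact_mod_cast le_max_left n m
    linarith
  · have : (m : ℝ) ≤ ((max n m : ℕ) : ℝ) := by exact_mod_cast le_max_right n m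
    linarith

lemma Adm.energy_of_tendsto (hp : 1 < p)
    (h : ∀ n, Adm p θ M L (u n) (u' n))
    (hw : ∀ r, 0 < r → Tendsto (fun n => u n r) atTop (nhds (w r))) :
    radialInt (p - 1) (fun r => |deriv w r| ^ p) ≤ ENNReal.ofReal M := by
  have hp0 : 0 < p := by linarith
  have meas : ∀ (v : ℝ → ℝ) (l : ℝ), 0 < l → ContinuousOn v (Set.Ioi 0) →
      AEMeasurable (fun t => |v (l * t) - v t|) (volume.restrict (Set.Ioi 0)) := by
    intro v l hl hv
    refine (ContinuousOn.aemeasurable ?_ measurableSet_Ioi)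
    refine ((hv.comp (by fun_prop) fun t ht => ?_).sub hv).abs
    exact mul_pos hl ht
  have h1 : ∀ d : ℝ, 0 < d → ∫⁻ t in Set.Ioi (0 : ℝ),
      ENNReal.ofReal ((|w ((1 + d) * t) - w t| / d) ^ p) * ENNReal.ofReal t⁻¹ ≤ ENNReal.ofReal M := by
    intro d hd
    have h2 : ∫⁻ t in Set.Ioi (0 : ℝ), ENNReal.ofReal (|w ((1 + d) * t) - w t| ^ p) *
        ENNReal.ofReal t⁻¹ ≤ ENNReal.ofReal d ^ p * ENNReal.ofReal M := by
      calc _ = ∫⁻ t in Set.Ioi (0 : ℝ), liminf (fun n =>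
              ENNReal.ofReal (|u n ((1 + d) * t) - u n t| ^ p) * ENNReal.ofReal t⁻¹) atTop := by
            refine setLIntegral_congr_fun measurableSet_Ioi fun t ht => ?_
            have ht : 0 < t := ht
            refine (Tendsto.liminf_eq ?_).symm
            refine ENNReal.Tendsto.mul_const (ENNReal.tendsto_ofReal ?_)
              (Or.inr ENNReal.ofReal_ne_top)
            exact (((hw _ (by positivity)).sub (hw _ ht)).abs).rpow_const (Or.inr hp0.le)
        _ ≤ liminf (fun n => ∫⁻ t in Set.Ioi (0 : ℝ),
              ENNReal.ofReal (|u n ((1 + d) * t) - u n t| ^ p) * ENNReal.ofReal t⁻¹) atTop :=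
            lintegral_liminf_le' fun n => (((meas (u n) (1 + d) (by linarith)
              (h n).continuousOn).pow_const p).ennreal_ofReal).mul (by fun_prop)
        _ ≤ liminf (fun _ : ℕ => ENNReal.ofReal d ^ p * ENNReal.ofReal M) atTop := by
            refine liminf_le_liminf (Eventually.of_forall fun n => ?_)
            refine ((h n).lintegral_quotient_le hp (by linarith : 1 < 1 + d)).trans ?_
            gcongr
            linarith [Real.log_le_sub_one_of_pos (by linarith : 0 < 1 + d)]
        _ = _ := liminf_const _
    have hdp : ENNReal.ofReal d ^ p ≠ 0 := by
      rw [ENNReal.ofReal_rpow_of_pos hd]; simp; positivity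
    have hdt : ENNReal.ofReal d ^ p ≠ ⊤ := ENNReal.rpow_ne_top_of_nonneg hp0.le ENNReal.ofReal_ne_top
    rw [← ENNReal.mul_le_mul_iff_right hdp hdt]
    refine le_trans (le_of_eq ?_) h2
    rw [← lintegral_const_mul' _ _ hdt]
    refine setLIntegral_congr_fun measurableSet_Ioi fun t ht => ?_
    rw [← mul_assoc, ENNReal.ofReal_rpow_of_pos hd, ← ENNReal.ofReal_mul (by positivity),
      ← Real.mul_rpow hd.le (by positivity), mul_div_cancel₀ _ hd.ne']
  set d : ℕ → ℝ := fun k => 1 / ((k : ℝ) + 1) with hd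
  have hd0 : ∀ k, 0 < d k := fun k => by positivity
  calc radialInt (p - 1) (fun r => |deriv w r| ^ p) 
      = ∫⁻ t in Set.Ioi (0 : ℝ), liminf (fun k => ENNReal.ofReal
          ((|w ((1 + d k) * t) - w t| / d k) ^ p) * ENNReal.ofReal t⁻¹) atTop := by
        unfold radialInt
        refine lintegral_congr_ae ?_
        filter_upwards [Adm.ae_differentiableAt_of_tendsto hp h hw,
          ae_restrict_mem measurableSet_Ioi] with t hdt ht
        have ht : 0 < t := ht
        refine (Tendsto.liminf_eq ?_).symm
        have t1 : Tendsto (fun k => d k * t) atTop (nhdsWithin 0 {0}ᶜ) := by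
          refine tendsto_nhdsWithin_iff.2 ⟨?_, Eventually.of_forall fun k =>
            (mul_pos (hd0 k) ht).ne'⟩
          simpa [hd] using tendsto_one_div_add_atTop_nhds_zero_nat.mul_const t
        have t2 := hdt.hasDerivAt.tendsto_slope_zero.comp t1
        have t3 := (t2.abs.rpow_const (p := p) (Or.inr hp0.le)).mul_const (t ^ (p - 1))
        have t4 := ENNReal.tendsto_ofReal t3
        rw [ENNReal.ofReal_mul (by positivity)] at t4
        refine t4.congr fun k => ?_
        rw [← ENNReal.ofReal_mul (by have := hd0 k; positivity)]
        congr 1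
        have hk := hd0 k
        simp only [Function.comp_apply, smul_eq_mul]
        rw [show t + d k * t = (1 + d k) * t by ring, abs_mul, abs_inv,
          abs_of_pos (mul_pos hk ht), Real.rpow_sub_one ht.ne', mul_div_assoc',
          ← Real.mul_rpow (by positivity) ht.le, div_eq_mul_inv]
        congr 2
        field_simp
    _ ≤ liminf (fun k => ∫⁻ t in Set.Ioi (0 : ℝ), ENNReal.ofReal
          ((|w ((1 + d k) * t) - w t| / d k) ^ p) * ENNReal.ofReal t⁻¹) atTop := by
        refine lintegral_liminf_le' fun k => ?_
        exact ((((meas w (1 + d k) (by linarith [hd0 k])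
          (Adm.continuousOn_of_tendsto hp h hw)).div_const _).pow_const p).ennreal_ofReal).mul
          (by fun_prop)
    _ ≤ liminf (fun _ : ℕ => ENNReal.ofReal M) atTop :=
        liminf_le_liminf (Eventually.of_forall fun k => h1 _ (hd0 k))
    _ = _ := liminf_const _

/-- Admissibility is closed under pointwise limits. -/
lemma Adm.of_tendsto (hp : 1 < p) (hM : 0 ≤ M) (hL : 0 ≤ L) (hθ : 0 ≤ θ)
    (h : ∀ n, Adm p θ M L (u n) (u' n))
    (hw : ∀ r, 0 < r → Tendsto (fun n => u n r) atTop (nhds (w r))) :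
    Adm p θ M L w (deriv w) where
  ftc_int a b ha hab := (Adm.absolutelyContinuous_of_tendsto hp h hw ha hab).intervalIntegrable_deriv
  ftc a b ha hab := (Adm.absolutelyContinuous_of_tendsto hp h hw ha hab).integral_deriv_eq_sub.symm
  lim_zero := by
    rw [Metric.tendsto_atTop]
    intro ε hε
    obtain ⟨R, hR, hdec⟩ := Adm.uniform_decay hp hM hL hθ (half_pos hε)
    refine ⟨R, fun r hr => ?_⟩
    rw [Real.dist_eq, sub_zero]
    exact lt_of_le_of_lt (le_of_tendsto' (hw r (hR.trans_le hr)).abs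
      fun n => hdec _ _ (h n) r hr) (half_lt_self hε)
  energy := Adm.energy_of_tendsto hp h hw
  mass := by
    have hp0 : 0 ≤ p := by linarith
    calc radialInt θ (fun r => |w r| ^ p) = ∫⁻ t in Set.Ioi (0 : ℝ), liminf (fun n =>
            ENNReal.ofReal (|u n t| ^ p) * ENNReal.ofReal (t ^ θ)) atTop := by
          refine setLIntegral_congr_fun measurableSet_Ioi fun t ht => ?_
          refine (Tendsto.liminf_eq ?_).symm
          exact ENNReal.Tendsto.mul_const (ENNReal.tendsto_ofReal
            ((hw t ht).abs.rpow_const (Or.inr hp0))) (Or.inr ENNReal.ofReal_ne_top)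
      _ ≤ liminf (fun n => ∫⁻ t in Set.Ioi (0 : ℝ),
            ENNReal.ofReal (|u n t| ^ p) * ENNReal.ofReal (t ^ θ)) atTop :=
          lintegral_liminf_le' fun n =>
            (((h n).aemeasurable.abs.pow_const p).ennreal_ofReal).mul (by fun_prop)
      _ ≤ liminf (fun _ : ℕ => ENNReal.ofReal L) atTop :=
          liminf_le_liminf (Eventually.of_forall fun n => (h n).mass)
      _ = _ := liminf_const _

end Limit

/-- The Taylor remainder `exp t - ∑_{j < m} t^j / j!`. -/
noncomputable def expTail (m : ℕ) (t : ℝ) : ℝ :=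
  Real.exp t - ∑ j ∈ Finset.range m, t ^ j / (Nat.factorial j : ℝ)

lemma phiP_eq_expTail (p t : ℝ) : phiP p t = expTail ⌈p - 1⌉₊ t := by
  have hs : HasSum (fun j : ℕ => t ^ j / (Nat.factorial j : ℝ)) (Real.exp t) := by
    rw [Real.exp_eq_exp_ℝ]
    exact NormedSpace.expSeries_div_hasSum_exp t
  have hf : HasSum (fun j : ℕ => if j ∈ Finset.range ⌈p - 1⌉₊ then
      t ^ j / (Nat.factorial j : ℝ) else 0)
      (∑ j ∈ Finset.range ⌈p - 1⌉₊, t ^ j / (Nat.factorial j : ℝ)) := by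
    have := hasSum_sum_of_ne_finset_zero (L := .unconditional ℕ) (f := fun j : ℕ => if j ∈ Finset.range ⌈p - 1⌉₊ then
      t ^ j / (Nat.factorial j : ℝ) else 0) (s := Finset.range ⌈p - 1⌉₊)
      (fun j hj => if_neg hj)
    convert this using 1
    exact Finset.sum_congr rfl fun j hj => (if_pos hj).symm
  unfold phiP expTail
  rw [← (hs.sub hf).tsum_eq]
  congr 1
  ext j
  simp only [← Nat.ceil_le, Finset.mem_range]
  split_ifs <;> first | omega | simp

lemma expTail_nonneg (m : ℕ) {t : ℝ} (ht : 0 ≤ t) : 0 ≤ expTail m t :=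
  sub_nonneg.2 (Real.sum_le_exp_of_nonneg ht m)

lemma pow_div_le_expTail (m : ℕ) {t : ℝ} (ht : 0 ≤ t) :
    t ^ m / (Nat.factorial m : ℝ) ≤ expTail m t := by
  have := Real.sum_le_exp_of_nonneg ht (m + 1)
  rw [Finset.sum_range_succ] at this
  unfold expTail
  linarith

lemma expTail_le_exp (m : ℕ) {t : ℝ} (ht : 0 ≤ t) : expTail m t ≤ Real.exp t :=
  sub_le_self _ (Finset.sum_nonneg fun _ _ => by positivity)

lemma expTail_le_pow_mul_exp (m : ℕ) {t : ℝ} (ht : 0 ≤ t) :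
    expTail m t ≤ t ^ m * Real.exp t := by
  have hs : HasSum (fun j : ℕ => t ^ j / (Nat.factorial j : ℝ)) (Real.exp t) := by
    rw [Real.exp_eq_exp_ℝ]
    exact NormedSpace.expSeries_div_hasSum_exp t
  refine hasSum_le (fun i => ?_) ((hasSum_nat_add_iff' m).2 hs) (hs.mul_left (t ^ m))
  rw [pow_add, mul_comm, mul_div_assoc]
  gcongr
  omega

lemma continuous_expTail (m : ℕ) : Continuous (expTail m) := by
  unfold expTail
  fun_prop

/-- The part of `φ_p(μ s^{p/(p-1)})` of order strictly higher than `s^p`. -/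
noncomputable def higherPart (p μ s : ℝ) : ℝ := expTail (⌊p - 1⌋₊ + 1) (μ * s ^ (p / (p - 1)))

/-- The coefficient of `s^p` in `φ_p(μ s^{p/(p-1)})`. -/
noncomputable def leadCoeff (p μ : ℝ) : ℝ :=
  if (⌈p - 1⌉₊ : ℝ) = p - 1 then μ ^ ⌈p - 1⌉₊ / (Nat.factorial ⌈p - 1⌉₊ : ℝ) else 0

lemma leadCoeff_nonneg {p μ : ℝ} (hμ : 0 < μ) : 0 ≤ leadCoeff p μ := by
  unfold leadCoeff
  split_ifs <;> positivity

lemma phiP_eq_add {p μ s : ℝ} (hp : 1 < p) (hs : 0 ≤ s) :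
    phiP p (μ * s ^ (p / (p - 1))) = leadCoeff p μ * s ^ p + higherPart p μ s := by
  have hp1 : 0 < p - 1 := by linarith
  rw [phiP_eq_expTail]
  unfold leadCoeff higherPart
  split_ifs with h
  · have hfl : ⌊p - 1⌋₊ = ⌈p - 1⌉₊ := by
      conv_lhs => rw [← h]
      exact Nat.floor_natCast _
    rw [hfl]
    unfold expTail
    rw [Finset.sum_range_succ]
    have : (s ^ (p / (p - 1))) ^ ⌈p - 1⌉₊ = s ^ p := by
      rw [← Real.rpow_natCast, ← Real.rpow_mul hs, h, div_mul_cancel₀ _ hp1.ne']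
    rw [mul_pow μ, this]
    ring
  · have hle : ⌈p - 1⌉₊ ≤ ⌊p - 1⌋₊ + 1 := Nat.ceil_le_floor_add_one _
    have hge : ⌊p - 1⌋₊ + 1 ≤ ⌈p - 1⌉₊ := by
      by_contra hlt
      have h1 : ⌈p - 1⌉₊ ≤ ⌊p - 1⌋₊ := by omega
      have h2 : (⌈p - 1⌉₊ : ℝ) ≤ ⌊p - 1⌋₊ := by exact_mod_cast h1
      exact h (le_antisymm (h2.trans (Nat.floor_le hp1.le)) (Nat.le_ceil _))
    rw [le_antisymm hle hge]
    ring

lemma higherPart_nonneg {p μ s : ℝ} (hμ : 0 < μ) (hs : 0 ≤ s) : 0 ≤ higherPart p μ s :=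
  expTail_nonneg _ (by positivity)

lemma higherPart_pos {p μ s : ℝ} (hμ : 0 < μ) (hs : 0 < s) : 0 < higherPart p μ s :=
  lt_of_lt_of_le (by positivity) (pow_div_le_expTail _ (by positivity))

lemma higherPart_zero {p μ : ℝ} (hp : 1 < p) : higherPart p μ 0 = 0 := by
  have hp1 : 0 < p - 1 := by linarith
  have : p / (p - 1) ≠ 0 := (div_pos (by linarith) hp1).ne'
  unfold higherPart
  rw [Real.zero_rpow this, mul_zero]
  refine le_antisymm ?_ (expTail_nonneg _ le_rfl)
  simpa using expTail_le_pow_mul_exp (⌊p - 1⌋₊ + 1) (le_refl (0 : ℝ))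

lemma continuous_higherPart {p μ : ℝ} (hp : 1 < p) : Continuous (higherPart p μ) := by
  have : 0 ≤ p / (p - 1) := div_nonneg (by linarith) (by linarith)
  exact (continuous_expTail _).comp (continuous_const.mul (Real.continuous_rpow_const this))

lemma higherPart_le_small {p μ ε : ℝ} (hp : 1 < p) (hμ : 0 < μ) (hε : 0 < ε) :
    ∃ η : ℝ, 0 < η ∧ ∀ s, 0 ≤ s → s ≤ η → higherPart p μ s ≤ ε * s ^ p := by
  have hp1 : 0 < p - 1 := by linarith
  set q := p / (p - 1) with hq
  have hq0 : 0 < q := div_pos (by linarith) hp1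
  set m := ⌊p - 1⌋₊ + 1 with hm
  have hmp : p - 1 < (m : ℝ) := by
    rw [hm]; push_cast; exact Nat.lt_floor_add_one _
  have hd : 0 < q * m - p := by
    have : q * (p - 1) = p := div_mul_cancel₀ _ hp1.ne'
    nlinarith
  have hc : ContinuousAt (fun s : ℝ => μ ^ m * s ^ (q * m - p) * Real.exp (μ * s ^ q)) 0 := by
    have c1 : Continuous (fun s : ℝ => s ^ (q * m - p)) := Real.continuous_rpow_const hd.le
    have c2 : Continuous (fun s : ℝ => s ^ q) := Real.continuous_rpow_const hq0.le
    exact (by fun_prop : Continuous _).continuousAt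
  have ht := hc.tendsto
  simp only [Real.zero_rpow hd.ne', mul_zero, zero_mul] at ht
  obtain ⟨η, hη, hb⟩ := Metric.eventually_nhds_iff.1 (ht.eventually (gt_mem_nhds hε))
  refine ⟨η / 2, by positivity, fun s hs0 hsη => ?_⟩
  have h1 := hb (y := s) (by rw [Real.dist_eq, sub_zero, abs_of_nonneg hs0]; linarith)
  calc higherPart p μ s ≤ (μ * s ^ q) ^ m * Real.exp (μ * s ^ q) :=
        expTail_le_pow_mul_exp _ (by positivity)
    _ = (μ ^ m * s ^ (q * m - p) * Real.exp (μ * s ^ q)) * s ^ p := by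
        have : (s ^ q) ^ m = s ^ (q * m - p) * s ^ p := by
          rw [← Real.rpow_natCast, ← Real.rpow_mul hs0, ← Real.rpow_add_of_nonneg hs0 hd.le (by linarith)]
          congr 1
          ring
        rw [mul_pow, this]
        ring
    _ ≤ _ := by gcongr

/-- Integrable domination near the origin in the subcritical range. -/
lemma exists_dominating {p θ M L μ R : ℝ} (hp : 1 < p) (hθ : 0 ≤ θ) (hM : 0 ≤ M) (hL : 0 ≤ L)
    (hμ : 0 < μ) (hsub : μ * M ^ (1 / (p - 1)) < θ + 1) (hR : 0 < R) :
    ∃ bound : ℝ → ℝ≥0∞, (∫⁻ r in Set.Ioc 0 R, bound r) ≠ ⊤ ∧ ∀ u u' : ℝ → ℝ, Adm p θ M L u u' →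
      ∀ r ∈ Set.Ioc 0 R, ENNReal.ofReal (higherPart p μ |u r|) * ENNReal.ofReal (r ^ θ) ≤ bound r := by
  have hp0 : 0 < p := by linarith
  have hp1 : 0 < p - 1 := by linarith
  set q := p / (p - 1) with hq
  have hq0 : 0 < q := div_pos (by linarith) hp1
  set κ := M ^ (1 / p) with hκ
  have hκ0 : 0 ≤ κ := by positivity
  obtain ⟨κ₁, hκ₁, hlt⟩ : ∃ κ₁, κ₁ ∈ Set.Ioi κ ∧ μ * κ₁ ^ q < θ + 1 := by
    have hc : ContinuousAt (fun x : ℝ => μ * x ^ q) κ :=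
      (continuous_const.mul (Real.continuous_rpow_const hq0.le)).continuousAt
    have e : μ * κ ^ q < θ + 1 := by
      have : κ ^ q = M ^ (1 / (p - 1)) := by
        rw [hκ, hq, ← Real.rpow_mul hM]; congr 1; field_simp
      rwa [this]
    have ev : ∀ᶠ x in nhdsWithin κ (Set.Ioi κ), x ∈ Set.Ioi κ := self_mem_nhdsWithin
    exact (ev.and (nhdsWithin_le_nhds (hc.tendsto.eventually (gt_mem_nhds e)))).exists
  have hκ₁ : κ < κ₁ := hκ₁
  set β := μ * κ₁ ^ q with hβ
  set B := ((L + 1) / ((2 * R - R) * R ^ θ)) ^ (1 / p) +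
      M ^ (1 / p) * Real.log (2 * R / R) ^ ((p - 1) / p) with hB
  have hlog2 : 0 ≤ Real.log (2 * R / R) := Real.log_nonneg (by
    rw [mul_div_cancel_right₀ _ hR.ne']; norm_num)
  have hB0 : 0 ≤ B := by
    have : 0 < 2 * R - R := by linarith
    positivity
  set C := μ * (B + κ * (B / (κ₁ - κ))) ^ q with hC
  have hκd : 0 < κ₁ - κ := sub_pos.2 hκ₁
  have hC0 : 0 ≤ C := by positivity
  refine ⟨fun r => ENNReal.ofReal (Real.exp C * R ^ β * r ^ (θ - β)), ?_, ?_⟩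
  · have hi : IntervalIntegrable (fun r : ℝ => Real.exp C * R ^ β * r ^ (θ - β)) volume 0 R :=
      (intervalIntegral.intervalIntegrable_rpow' (by linarith)).const_mul _
    exact ((intervalIntegrable_iff_integrableOn_Ioc_of_le hR.le).1 hi).lintegral_lt_top.ne
  · intro u u' h r hr
    have hr0 : 0 < r := hr.1
    rw [← ENNReal.ofReal_mul (higherPart_nonneg hμ (abs_nonneg _))]
    apply ENNReal.ofReal_le_ofReal
    set l := Real.log (R / r) with hl
    have hl0 : 0 ≤ l := Real.log_nonneg ((one_le_div hr0).2 hr.2)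
    set x := l ^ ((p - 1) / p) with hx
    have hx0 : 0 ≤ x := by positivity
    have hxq : x ^ q = l := by
      rw [hx, hq, ← Real.rpow_mul hl0, div_mul_div_comm, mul_comm p, div_self (by positivity),
        Real.rpow_one]
    have hur : |u r| ≤ B + κ * x := by
      have h1 := h.abs_le hp hM hL hθ hR (b := 2 * R) (by linarith)
      have h2 := h.abs_sub_le hp hM hr0 hr.2
      have := abs_sub_abs_le_abs_sub (u r) (u R)
      rw [abs_sub_comm] at this
      linarith
    have hexp : μ * |u r| ^ q ≤ β * l + C := by
      have h1 : μ * |u r| ^ q ≤ μ * (B + κ * x) ^ q := by gcongr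
      refine h1.trans ?_
      rcases le_total B ((κ₁ - κ) * x) with hc | hc
      · have : μ * (B + κ * x) ^ q ≤ μ * (κ₁ * x) ^ q := by
          gcongr
          linarith
        rw [Real.mul_rpow (by linarith) hx0, hxq, ← mul_assoc] at this
        linarith
      · have hxB : x ≤ B / (κ₁ - κ) := (le_div_iff₀ hκd).2 (by linarith)
        have h2 : μ * (B + κ * x) ^ q ≤ C := by rw [hC]; gcongr
        have : 0 ≤ β * l := by
          have : 0 < κ₁ := by linarith
          positivity
        linarith
    have h3 : higherPart p μ |u r| ≤ Real.exp C * (R ^ β * r ^ (-β)) := by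
      calc higherPart p μ |u r| ≤ Real.exp (μ * |u r| ^ q) := expTail_le_exp _ (by positivity)
        _ ≤ Real.exp (β * l + C) := Real.exp_le_exp.2 hexp
        _ = _ := by
          rw [Real.exp_add, mul_comm, mul_comm β l, hl, ← Real.rpow_def_of_pos (by positivity),
            Real.div_rpow hR.le hr0.le, Real.rpow_neg hr0.le, div_eq_mul_inv]
    calc higherPart p μ |u r| * r ^ θ ≤ Real.exp C * (R ^ β * r ^ (-β)) * r ^ θ := by gcongr
      _ = _ := by rw [sub_eq_neg_add, Real.rpow_add hr0]; ring

lemma radialInt_const_mul (θ : ℝ) {c : ℝ} (hc : 0 ≤ c) (f : ℝ → ℝ) :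
    radialInt θ (fun r => c * f r) = ENNReal.ofReal c * radialInt θ f := by
  unfold radialInt
  rw [← lintegral_const_mul' _ _ ENNReal.ofReal_ne_top]
  congr 1
  ext r
  rw [ENNReal.ofReal_mul hc, mul_assoc]

lemma radialInt_comp_mul (θ : ℝ) {l : ℝ} (hl : 0 < l) (f : ℝ → ℝ) :
    radialInt θ (fun r => f (l * r)) = ENNReal.ofReal (l ^ (-(θ + 1))) * radialInt θ f := by
  set g : ℝ → ℝ≥0∞ := (Set.Ioi (0 : ℝ)).indicator
    fun r => ENNReal.ofReal (f r) * ENNReal.ofReal (r ^ θ) with hg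
  have h1 : ∫⁻ x, g (l * x) = ENNReal.ofReal l⁻¹ * ∫⁻ x, g x := by
    have e : MeasurableEmbedding (fun x : ℝ => l * x) :=
      (Homeomorph.mulLeft₀ l hl.ne').measurableEmbedding
    rw [← e.lintegral_map, Real.map_volume_mul_left hl.ne', lintegral_smul_measure, abs_of_pos
      (inv_pos.2 hl), smul_eq_mul]
  have h2 : ∫⁻ x, g (l * x) = ENNReal.ofReal (l ^ θ) * radialInt θ (fun r => f (l * r)) := by
    unfold radialInt
    rw [← lintegral_const_mul' _ _ ENNReal.ofReal_ne_top, ← lintegral_indicator measurableSet_Ioi]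
    congr 1
    ext x
    by_cases hx : 0 < x
    · rw [Set.indicator_of_mem (Set.mem_Ioi.2 hx), hg,
        Set.indicator_of_mem (Set.mem_Ioi.2 (mul_pos hl hx)), Real.mul_rpow hl.le hx.le,
        ENNReal.ofReal_mul (by positivity)]
      ring
    · rw [Set.indicator_of_notMem (by simpa using hx), hg, Set.indicator_of_notMem]
      simp only [Set.mem_Ioi, not_lt] at hx ⊢
      exact mul_nonpos_of_nonneg_of_nonpos hl.le hx
  have h3 : ∫⁻ x, g x = radialInt θ f := lintegral_indicator measurableSet_Ioi _
  rw [h2, h3] at h1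
  have e1 : ENNReal.ofReal (l ^ (-θ)) * ENNReal.ofReal (l ^ θ) = 1 := by
    rw [← ENNReal.ofReal_mul (by positivity), ← Real.rpow_add hl]
    simp
  have e2 : ENNReal.ofReal (l ^ (-(θ + 1))) = ENNReal.ofReal (l ^ (-θ)) * ENNReal.ofReal l⁻¹ := by
    rw [← ENNReal.ofReal_mul (by positivity), neg_add, Real.rpow_add hl, Real.rpow_neg_one]
  rw [e2, mul_assoc, ← h1, ← mul_assoc, e1, one_mul]

lemma Adm.higherPart_limit {p θ M L μ : ℝ} (hp : 1 < p) (hM : 0 ≤ M) (hL : 0 ≤ L) (hθ : 0 ≤ θ)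
    (hμ : 0 < μ) (hsub : μ * M ^ (1 / (p - 1)) < θ + 1) {u u' : ℕ → ℝ → ℝ} {w : ℝ → ℝ}
    (h : ∀ n, Adm p θ M L (u n) (u' n))
    (hw : ∀ r, 0 < r → Tendsto (fun n => u n r) atTop (nhds (w r))) {ε : ℝ} (hε : 0 < ε) :
    ∃ (J : ℕ → ℝ≥0∞) (j : ℝ≥0∞), Tendsto J atTop (nhds j) ∧
      j ≤ radialInt θ (fun r => higherPart p μ |w r|) ∧
      ∀ n, radialInt θ (fun r => higherPart p μ |u n r|) ≤ J n + ENNReal.ofReal ε := by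
  obtain ⟨η, hη, hsmall⟩ := higherPart_le_small (μ := μ) (ε := ε / (L + 1)) hp hμ (by positivity)
  obtain ⟨R, hR, hdec⟩ := Adm.uniform_decay hp hM hL hθ hη
  obtain ⟨bound, hbt, hb⟩ := exists_dominating hp hθ hM hL hμ hsub hR
  have hsubset : Set.Ioc 0 R ⊆ Set.Ioi 0 := fun x hx => hx.1
  refine ⟨fun n => ∫⁻ r in Set.Ioc 0 R, ENNReal.ofReal (higherPart p μ |u n r|) *
    ENNReal.ofReal (r ^ θ), ∫⁻ r in Set.Ioc 0 R, ENNReal.ofReal (higherPart p μ |w r|) *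
    ENNReal.ofReal (r ^ θ), ?_, lintegral_mono_set hsubset, fun n => ?_⟩
  · refine tendsto_lintegral_of_dominated_convergence' bound (fun n => ?_) (fun n => ?_) hbt ?_
    · have : AEMeasurable (u n) (volume.restrict (Set.Ioc 0 R)) :=
        (h n).aemeasurable.mono_measure (Measure.restrict_mono hsubset le_rfl)
      exact (((continuous_higherPart hp).comp continuous_abs).measurable.comp_aemeasurable
        this).ennreal_ofReal.mul (by fun_prop)
    · filter_upwards [ae_restrict_mem measurableSet_Ioc] with r hr
      exact hb _ _ (h n) r hr
    · filter_upwards [ae_restrict_mem measurableSet_Ioc] with r hr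
      refine ENNReal.Tendsto.mul_const (ENNReal.tendsto_ofReal ?_) (Or.inr ENNReal.ofReal_ne_top)
      exact ((continuous_higherPart hp).tendsto _).comp (hw r hr.1).abs
  · unfold radialInt
    rw [← Set.Ioc_union_Ioi_eq_Ioi hR.le,
      lintegral_union measurableSet_Ioi (Set.Ioc_disjoint_Ioi le_rfl)]
    gcongr
    calc ∫⁻ r in Set.Ioi R, ENNReal.ofReal (higherPart p μ |u n r|) * ENNReal.ofReal (r ^ θ)
        ≤ ∫⁻ r in Set.Ioi R, ENNReal.ofReal (ε / (L + 1)) *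
            (ENNReal.ofReal (|u n r| ^ p) * ENNReal.ofReal (r ^ θ)) := by
          refine setLIntegral_mono' measurableSet_Ioi fun r hr => ?_
          rw [← mul_assoc]
          refine mul_le_mul' ?_ le_rfl
          rw [← ENNReal.ofReal_mul (by positivity : 0 ≤ ε / (L + 1))]
          apply ENNReal.ofReal_le_ofReal
          exact hsmall _ (abs_nonneg _) (hdec _ _ (h n) r (le_of_lt hr))
      _ = ENNReal.ofReal (ε / (L + 1)) * ∫⁻ r in Set.Ioi R,
            (ENNReal.ofReal (|u n r| ^ p) * ENNReal.ofReal (r ^ θ)) :=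
          lintegral_const_mul' _ _ ENNReal.ofReal_ne_top
      _ ≤ ENNReal.ofReal (ε / (L + 1)) * ENNReal.ofReal L := by
          gcongr
          exact (lintegral_mono_set (Set.Ioi_subset_Ioi hR.le)).trans (h n).mass
      _ ≤ ENNReal.ofReal ε := by
          rw [← ENNReal.ofReal_mul (by positivity)]
          apply ENNReal.ofReal_le_ofReal
          rw [div_mul_eq_mul_div, div_le_iff₀ (by positivity)]
          nlinarith

lemma omegaW_pos {θ : ℝ} (hθ : 0 ≤ θ) : 0 < omegaW θ := by
  have : 0 < Real.Gamma ((θ + 1) / 2) := Real.Gamma_pos_of_pos (by linarith)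
  unfold omegaW
  positivity

lemma wInt_eq (θ : ℝ) (f : ℝ → ℝ) : wInt θ f = ENNReal.ofReal (omegaW θ) * radialInt θ f := rfl

lemma wInt_le_iff {θ : ℝ} (hθ : 0 ≤ θ) (f : ℝ → ℝ) :
    wInt θ f ≤ 1 ↔ radialInt θ f ≤ ENNReal.ofReal (1 / omegaW θ) := by
  have h := omegaW_pos hθ
  rw [wInt_eq, one_div, ENNReal.ofReal_inv_of_pos h, mul_comm, ← ENNReal.le_div_iff_mul_le
    (Or.inl (by simpa using h)) (Or.inl ENNReal.ofReal_ne_top), one_div]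

lemma wNorm_le_one_iff {θ p : ℝ} (hp : 0 < p) (u : ℝ → ℝ) :
    wNorm θ p u ≤ 1 ↔ wInt θ (fun r => |u r| ^ p) ≤ 1 := by
  have h := ENNReal.rpow_le_rpow_iff (x := wInt θ fun r => |u r| ^ p) (y := 1)
    (one_div_pos.2 hp)
  rwa [ENNReal.one_rpow] at h

lemma wNorm_lt_top_iff {θ p : ℝ} (hp : 0 < p) (u : ℝ → ℝ) :
    wNorm θ p u < ⊤ ↔ wInt θ (fun r => |u r| ^ p) < ⊤ :=
  ENNReal.rpow_lt_top_iff_of_pos (by positivity)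

lemma wNorm_rpow_neg {θ p : ℝ} (hp : 0 < p) (u : ℝ → ℝ) :
    wNorm θ p u ^ (-p) = (wInt θ (fun r => |u r| ^ p))⁻¹ := by
  unfold wNorm
  rw [← ENNReal.rpow_mul, show 1 / p * -p = -1 by field_simp, ENNReal.rpow_neg_one]

lemma adm_iff_memX {p θ : ℝ} (hp : 1 < p) (hθ : 0 ≤ θ) {u u' : ℝ → ℝ}
    (hN : wInt θ (fun r => |u r| ^ p) ≤ 1) :
    Adm p θ (1 / omegaW (p - 1)) (1 / omegaW θ) u u' ↔
      MemX p (p - 1) θ u u' ∧ wNorm (p - 1) p u' ≤ 1 := by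
  have hp0 : 0 < p := by linarith
  constructor
  · intro h
    have h1 : wNorm (p - 1) p u' ≤ 1 :=
      (wNorm_le_one_iff hp0 _).2 ((wInt_le_iff (by linarith) _).2 h.energy)
    exact ⟨⟨h.ftc_int, h.ftc, h.lim_zero,
      ((wNorm_le_one_iff hp0 _).2 hN).trans_lt ENNReal.one_lt_top,
      h1.trans_lt ENNReal.one_lt_top⟩, h1⟩
  · rintro ⟨h, h1⟩
    exact ⟨h.ftc_int, h.ftc, h.lim_zero,
      (wInt_le_iff (by linarith) _).1 ((wNorm_le_one_iff hp0 _).1 h1), (wInt_le_iff hθ _).1 hN⟩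

lemma TMfunc_eq {p θ μ : ℝ} (hp : 1 < p) (hμ : 0 < μ) {u : ℝ → ℝ}
    (hu : AEMeasurable u (volume.restrict (Set.Ioi 0))) :
    TMfunc p θ μ u = ENNReal.ofReal (leadCoeff p μ) * wInt θ (fun r => |u r| ^ p) +
      wInt θ (fun r => higherPart p μ |u r|) := by
  have hc := leadCoeff_nonneg (p := p) hμ
  unfold TMfunc
  rw [wInt_eq, wInt_eq, wInt_eq, mul_left_comm, ← mul_add, ← radialInt_const_mul _ hc]
  congr 1
  unfold radialInt
  have hm : AEMeasurable (fun r => ENNReal.ofReal (leadCoeff p μ * |u r| ^ p) *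
      ENNReal.ofReal (r ^ θ)) (volume.restrict (Set.Ioi 0)) :=
    (((hu.abs.pow_const p).const_mul _).ennreal_ofReal).mul (by fun_prop)
  refine Eq.trans ?_ (lintegral_add_left' hm _)
  congr 1
  ext r
  beta_reduce
  rw [phiP_eq_add hp (abs_nonneg _), ENNReal.ofReal_add (by positivity)
    (higherPart_nonneg hμ (abs_nonneg _)), add_mul]

lemma wInt_higherPart_eq_zero {p θ μ : ℝ} (hp : 1 < p) {u : ℝ → ℝ}
    (hu : AEMeasurable u (volume.restrict (Set.Ioi 0)))
    (h : wInt θ (fun r => |u r| ^ p) = 0) (hθ : 0 ≤ θ) :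
    wInt θ (fun r => higherPart p μ |u r|) = 0 := by
  rw [wInt_eq, mul_eq_zero] at h ⊢
  right
  have h1 : radialInt θ (fun r => |u r| ^ p) = 0 :=
    h.resolve_left (by simpa using omegaW_pos hθ)
  unfold radialInt at h1 ⊢
  have hm : AEMeasurable (fun r => ENNReal.ofReal (|u r| ^ p) *
      ENNReal.ofReal (r ^ θ)) (volume.restrict (Set.Ioi 0)) :=
    ((hu.abs.pow_const p).ennreal_ofReal).mul (by fun_prop)
  replace h1 := (lintegral_eq_zero_iff' hm).1 h1
  rw [← lintegral_zero (μ := volume.restrict (Set.Ioi (0 : ℝ)))]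
  refine lintegral_congr_ae ?_
  filter_upwards [h1, ae_restrict_mem measurableSet_Ioi] with r hr hr0
  have hr0 : 0 < r := hr0
  have hrθ : 0 < r ^ θ := by positivity
  have : u r = 0 := by
    by_contra hne
    have : 0 < |u r| ^ p := by positivity
    simp only [Pi.zero_apply, mul_eq_zero, ENNReal.ofReal_eq_zero] at hr
    rcases hr with hr | hr <;> linarith
  simp [this, higherPart_zero hp]

/-- The normalised quotient splits into the leading coefficient and the higher-order part. -/
lemma ratio_eq {p θ μ : ℝ} (hp : 1 < p) (hμ : 0 < μ) {u : ℝ → ℝ}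
    (hu : AEMeasurable u (volume.restrict (Set.Ioi 0)))
    (h0 : wInt θ (fun r => |u r| ^ p) ≠ 0) (ht : wInt θ (fun r => |u r| ^ p) ≠ ⊤) :
    wNorm θ p u ^ (-p) * TMfunc p θ μ u = ENNReal.ofReal (leadCoeff p μ) +
      (wInt θ (fun r => |u r| ^ p))⁻¹ * wInt θ (fun r => higherPart p μ |u r|) := by
  rw [wNorm_rpow_neg (by linarith), TMfunc_eq hp hμ hu, mul_add, mul_left_comm,
    ENNReal.inv_mul_cancel h0 ht, mul_one]

lemma MemX.aemeasurable {p θ : ℝ} (hp : 1 < p) (hθ : 0 ≤ θ) {u u' : ℝ → ℝ}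
    (h : MemX p (p - 1) θ u u') : AEMeasurable u (volume.restrict (Set.Ioi 0)) := by
  have hfin : ∀ {η : ℝ}, 0 ≤ η → ∀ v : ℝ → ℝ, wNorm η p v < ⊤ →
      radialInt η (fun r => |v r| ^ p) ≠ ⊤ := fun hη v hv htop => by
    have h1 := ((wNorm_lt_top_iff (by linarith) _).1 hv).ne
    rw [wInt_eq, htop] at h1
    exact h1 (ENNReal.mul_top (by simpa using omegaW_pos hη))
  have hA : Adm p θ (radialInt (p - 1) (fun r => |u' r| ^ p)).toReal
      (radialInt θ (fun r => |u r| ^ p)).toReal u u' :=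
    ⟨h.ftc_int, h.ftc, h.lim_zero,
      (ENNReal.ofReal_toReal (hfin (by linarith) _ h.fin_u')).ge,
      (ENNReal.ofReal_toReal (hfin hθ _ h.fin_u)).ge⟩
  exact hA.aemeasurable

/-- Dilation to unit mass preserves the energy and the quotient. -/
lemma exists_normalized {p θ μ : ℝ} (hp : 1 < p) (hθ : 0 ≤ θ) (hμ : 0 < μ) {u u' : ℝ → ℝ}
    (h : MemX p (p - 1) θ u u') (h1 : wNorm (p - 1) p u' ≤ 1)
    (h0 : wInt θ (fun r => |u r| ^ p) ≠ 0) :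
    ∃ v v' : ℝ → ℝ, Adm p θ (1 / omegaW (p - 1)) (1 / omegaW θ) v v' ∧
      wNorm θ p u ^ (-p) * TMfunc p θ μ u = ENNReal.ofReal (leadCoeff p μ) +
        wInt θ (fun r => higherPart p μ |v r|) := by
  have hp0 : 0 < p := by linarith
  set N := wInt θ (fun r => |u r| ^ p) with hN
  have hNt : N ≠ ⊤ := ((wNorm_lt_top_iff hp0 _).1 h.fin_u).ne
  have hN0 : 0 < N.toReal := ENNReal.toReal_pos h0 hNt
  set l := N.toReal ^ (1 / (θ + 1)) with hl
  have hl0 : 0 < l := by positivity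
  have hlN : ENNReal.ofReal (l ^ (-(θ + 1))) = N⁻¹ := by
    rw [hl, ← Real.rpow_mul hN0.le, show 1 / (θ + 1) * -(θ + 1) = -1 by field_simp,
      Real.rpow_neg_one, ENNReal.ofReal_inv_of_pos hN0, ENNReal.ofReal_toReal hNt]
  have hscale : ∀ f : ℝ → ℝ, wInt θ (fun r => f (l * r)) = N⁻¹ * wInt θ f := fun f => by
    rw [wInt_eq, radialInt_comp_mul _ hl0, hlN, mul_left_comm, ← wInt_eq]
  have hmass : wInt θ (fun r => |u (l * r)| ^ p) = 1 := by
    rw [hscale (fun r => |u r| ^ p), ENNReal.inv_mul_cancel h0 hNt]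
  have henergy : wInt (p - 1) (fun r => |l * u' (l * r)| ^ p) ≤ 1 := by
    have e : (fun r => |l * u' (l * r)| ^ p) = fun r => l ^ p * |u' (l * r)| ^ p := by
      ext r
      rw [abs_mul, abs_of_pos hl0, Real.mul_rpow hl0.le (abs_nonneg _)]
    rw [e, wInt_eq, radialInt_const_mul _ (by positivity),
      radialInt_comp_mul _ hl0 (fun r => |u' r| ^ p), ← mul_assoc (ENNReal.ofReal (l ^ p)),
      ← ENNReal.ofReal_mul (by positivity), ← Real.rpow_add hl0]
    simp only [sub_add_cancel, add_neg_cancel, Real.rpow_zero, ENNReal.ofReal_one, one_mul]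
    exact (wNorm_le_one_iff hp0 _).1 h1
  refine ⟨fun r => u (l * r), fun r => l * u' (l * r), ⟨?_, ?_, ?_, ?_, ?_⟩, ?_⟩
  · intro a b ha hab
    have := (h.ftc_int (l * a) (l * b) (by positivity) (by gcongr)).comp_mul_left (c := l)
    simp only [mul_div_cancel_left₀ _ hl0.ne'] at this
    exact this.const_mul l
  · intro a b ha hab
    rw [h.ftc (l * a) (l * b) (by positivity) (by gcongr), intervalIntegral.integral_const_mul,
      intervalIntegral.mul_integral_comp_mul_left]
  · exact h.lim_zero.comp (tendsto_id.const_mul_atTop hl0)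
  · exact (wInt_le_iff (by linarith) _).1 henergy
  · exact (wInt_le_iff hθ _).1 hmass.le
  · rw [ratio_eq hp hμ (h.aemeasurable hp hθ) h0 hNt, hscale (fun r => higherPart p μ |u r|)]

/-- A nonzero competitor with unit energy: a small multiple of the tent `max 0 (1 - r)`. -/
lemma exists_competitor {p θ μ : ℝ} (hp : 1 < p) (hθ : 0 ≤ θ) (hμ : 0 < μ) :
    ∃ u u' : ℝ → ℝ, MemX p (p - 1) θ u u' ∧ wNorm (p - 1) p u' ≤ 1 ∧
      wInt θ (fun r => higherPart p μ |u r|) ≠ 0 := by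
  have hp0 : 0 < p := by linarith
  have hω := omegaW_pos (θ := p - 1) (by linarith)
  set ε := (1 / omegaW (p - 1)) ^ (1 / p) with hε
  have hε0 : 0 < ε := by positivity
  have hεp : ε ^ p = 1 / omegaW (p - 1) := by
    rw [hε, ← Real.rpow_mul (by positivity), one_div_mul_cancel hp0.ne', Real.rpow_one]
  set u : ℝ → ℝ := fun r => ε * max 0 (1 - r) with hu
  have hlip : LipschitzWith ε.toNNReal u := by
    refine LipschitzWith.of_dist_le_mul fun x y => ?_
    rw [Real.coe_toNNReal _ hε0.le, Real.dist_eq, Real.dist_eq, ← mul_sub, abs_mul, abs_of_pos hε0]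
    refine mul_le_mul_of_nonneg_left ?_ hε0.le
    have := abs_max_sub_max_le_max 0 (1 - x) 0 (1 - y)
    simpa [abs_sub_comm] using this
  have hd : ∀ r, |deriv u r| ≤ ε := fun r => by
    simpa [Real.coe_toNNReal _ hε0.le] using norm_deriv_le_of_lipschitz (x₀ := r) hlip
  have hu1 : ∀ r, 1 ≤ r → u r = 0 := fun r hr => by
    simp [hu, hr]
  have hd1 : ∀ r, 1 < r → deriv u r = 0 := fun r hr => by
    have : u =ᶠ[nhds r] fun _ => 0 := by
      filter_upwards [lt_mem_nhds hr] with x hx using hu1 x hx.le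
    rw [this.deriv_eq, deriv_const]
  have hbound : ∀ r, 0 < r → |u r| ≤ ε := fun r hr => by
    rw [hu]
    beta_reduce
    rw [abs_of_nonneg (by positivity)]
    exact mul_le_of_le_one_right hε0.le (max_le zero_le_one (by linarith))
  have key : ∀ {η : ℝ}, 0 ≤ η → ∀ v : ℝ → ℝ, (∀ r, 0 < r → |v r| ≤ ε) → (∀ r, 1 < r → v r = 0) →
      radialInt η (fun r => |v r| ^ p) ≤ ENNReal.ofReal (1 / omegaW (p - 1)) := by
    intro η hη v hv hv1
    unfold radialInt
    calc ∫⁻ r in Set.Ioi 0, ENNReal.ofReal (|v r| ^ p) * ENNReal.ofReal (r ^ η)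
        ≤ ∫⁻ r in Set.Ioi (0 : ℝ), (Set.Ioc (0 : ℝ) 1).indicator
            (fun _ => ENNReal.ofReal (1 / omegaW (p - 1))) r := by
          refine setLIntegral_mono' measurableSet_Ioi fun r hr => ?_
          have hr : 0 < r := hr
          by_cases h1 : r ≤ 1
          · rw [Set.indicator_of_mem (Set.mem_Ioc.2 ⟨hr, h1⟩), ← ENNReal.ofReal_mul (by positivity),
              ← hεp]
            apply ENNReal.ofReal_le_ofReal
            calc |v r| ^ p * r ^ η ≤ ε ^ p * 1 := by
                  gcongr
                  · exact hv r hr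
                  · exact Real.rpow_le_one hr.le h1 hη
              _ = ε ^ p := mul_one _
          · rw [hv1 r (not_le.1 h1), abs_zero, Real.zero_rpow hp0.ne']
            simp
      _ ≤ ∫⁻ r, (Set.Ioc (0 : ℝ) 1).indicator
            (fun _ => ENNReal.ofReal (1 / omegaW (p - 1))) r := setLIntegral_le_lintegral _ _
      _ = ENNReal.ofReal (1 / omegaW (p - 1)) := by
          rw [lintegral_indicator_const measurableSet_Ioc]
          simp
  have hE : wNorm (p - 1) p (deriv u) ≤ 1 :=
    (wNorm_le_one_iff hp0 _).2 ((wInt_le_iff (by linarith) _).2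
      (key (by linarith) _ (fun r _ => hd r) hd1))
  have hac : ∀ a b : ℝ, AbsolutelyContinuousOnInterval u a b := fun a b =>
    (hlip.lipschitzOnWith (s := Set.uIcc a b)).absolutelyContinuousOnInterval
  refine ⟨u, deriv u, ⟨fun a b _ _ => (hac a b).intervalIntegrable_deriv,
    fun a b _ _ => (hac a b).integral_deriv_eq_sub.symm, ?_, ?_, hE.trans_lt ENNReal.one_lt_top⟩,
    hE, ?_⟩
  · refine tendsto_const_nhds.congr' ?_
    filter_upwards [eventually_ge_atTop 1] with r hr using (hu1 r hr).symm
  · rw [wNorm_lt_top_iff hp0, wInt_eq]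
    exact ENNReal.mul_lt_top ENNReal.ofReal_lt_top
      ((key hθ u hbound fun r hr => hu1 r hr.le).trans_lt ENNReal.ofReal_lt_top)
  · intro h0
    rw [wInt_eq, mul_eq_zero] at h0
    have h1 := h0.resolve_left (by simpa using omegaW_pos hθ)
    have hm : AEMeasurable (fun r => ENNReal.ofReal (higherPart p μ |u r|) *
        ENNReal.ofReal (r ^ θ)) (volume.restrict (Set.Ioi 0)) :=
      (((continuous_higherPart hp).comp
        (continuous_abs.comp hlip.continuous)).measurable.ennreal_ofReal.mul
          (by fun_prop)).aemeasurable
    have h2 := (lintegral_eq_zero_iff' hm).1 h1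
    have h3 : ∀ᵐ r ∂(volume.restrict (Set.Ioo (0 : ℝ) 1)), False := by
      filter_upwards [ae_mono (Measure.restrict_mono (fun x hx => hx.1) le_rfl) h2,
        ae_restrict_mem measurableSet_Ioo] with r hr hr0
      have hur : 0 < u r := mul_pos hε0 (lt_max_of_lt_right (by linarith [hr0.2]))
      have hg : 0 < higherPart p μ |u r| := higherPart_pos hμ (abs_pos.2 hur.ne')
      have hrθ : 0 < r ^ θ := Real.rpow_pos_of_pos hr0.1 _
      simp only [Pi.zero_apply, mul_eq_zero, ENNReal.ofReal_eq_zero] at hr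
      rcases hr with hr | hr <;> linarith
    rw [eventually_false_iff_eq_bot, ae_eq_bot, Measure.restrict_eq_zero] at h3
    simp at h3

/-- The higher-order part attains its supremum over the admissible class. -/
lemma exists_maximizer {p θ μ : ℝ} (hp : 1 < p) (hθ : 0 ≤ θ) (hμ : 0 < μ)
    (hμ' : μ < muC (p - 1) θ) {v v' : ℝ → ℝ}
    (hv : Adm p θ (1 / omegaW (p - 1)) (1 / omegaW θ) v v') :
    ∃ w w' : ℝ → ℝ, Adm p θ (1 / omegaW (p - 1)) (1 / omegaW θ) w w' ∧
      ∀ v v' : ℝ → ℝ, Adm p θ (1 / omegaW (p - 1)) (1 / omegaW θ) v v' →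
        wInt θ (fun r => higherPart p μ |v r|) ≤ wInt θ (fun r => higherPart p μ |w r|) := by
  have hω := omegaW_pos (θ := p - 1) (by linarith)
  have hω' := omegaW_pos hθ
  set M := 1 / omegaW (p - 1) with hM
  set L := 1 / omegaW θ with hL
  have hM0 : 0 ≤ M := by positivity
  have hL0 : 0 ≤ L := by positivity
  have hsub : μ * M ^ (1 / (p - 1)) < θ + 1 := by
    have h1 : 0 < omegaW (p - 1) ^ (1 / (p - 1)) := by positivity
    rw [hM, one_div (omegaW _), Real.inv_rpow hω.le, ← div_eq_mul_inv, div_lt_iff₀ h1]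
    exact hμ'
  set T : Set ℝ≥0∞ := {x | ∃ v v' : ℝ → ℝ, Adm p θ M L v v' ∧
    x = radialInt θ (fun r => higherPart p μ |v r|)} with hT
  obtain ⟨x, -, hx, hxT⟩ := exists_seq_tendsto_sSup (S := T) ⟨_, v, v', hv, rfl⟩
    (OrderTop.bddAbove _)
  choose u u' hu hxu using hxT
  obtain ⟨φ, hφ, w, hw⟩ := Adm.exists_subseq hp hM0 hL0 hθ hu
  have hwA := Adm.of_tendsto hp hM0 hL0 hθ (fun n => hu (φ n)) hw
  have hsup : sSup T ≤ radialInt θ (fun r => higherPart p μ |w r|) := by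
    refine ENNReal.le_of_forall_pos_le_add fun ε hε _ => ?_
    obtain ⟨J, j, hJ, hj, hle⟩ := Adm.higherPart_limit hp hM0 hL0 hθ hμ hsub
      (fun n => hu (φ n)) hw (ε := ε) hε
    rw [ENNReal.ofReal_coe_nnreal] at hle
    refine (le_of_tendsto_of_tendsto' (hx.comp hφ.tendsto_atTop) (hJ.add_const _) fun n => ?_).trans
      (add_le_add_left hj _)
    exact (hxu (φ n)).le.trans (hle n)
  refine ⟨w, deriv w, hwA, fun v v' h => ?_⟩
  have hmem : radialInt θ (fun r => higherPart p μ |v r|) ∈ T := ⟨v, v', h, rfl⟩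
  rw [wInt_eq, wInt_eq]
  exact mul_le_mul' le_rfl ((le_sSup hmem).trans hsup)

theorem stmt_6 (p α θ μ : ℝ) (hp : 2 ≤ p) (hα : α = p - 1) (hθ : 0 ≤ θ)
    (hμ : 0 < μ) (hμ' : μ < muC α θ) :
    ∃ u u' : ℝ → ℝ, MemX p α θ u u' ∧ u ≠ 0 ∧ wNorm α p u' ≤ 1 ∧
      TMSC p α θ μ = (wNorm θ p u) ^ (-p) * TMfunc p θ μ u := by
  subst hα
  have hp1 : 1 < p := by linarith
  have hp0 : 0 < p := by linarith
  obtain ⟨u₀, u₀', hX₀, hE₀, hG₀⟩ := exists_competitor hp1 hθ hμ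
  have hN₀ : wInt θ (fun r => |u₀ r| ^ p) ≠ 0 := fun h =>
    hG₀ (wInt_higherPart_eq_zero hp1 (hX₀.aemeasurable hp1 hθ) h hθ)
  obtain ⟨v₀, v₀', hA₀, hr₀⟩ := exists_normalized hp1 hθ hμ hX₀ hE₀ hN₀
  obtain ⟨w, w', hw, hmax⟩ := exists_maximizer hp1 hθ hμ hμ' hA₀
  have hv₀ : wInt θ (fun r => higherPart p μ |v₀ r|) ≠ 0 := by
    intro h0
    rw [ratio_eq hp1 hμ (hX₀.aemeasurable hp1 hθ) hN₀
      ((wNorm_lt_top_iff hp0 _).1 hX₀.fin_u).ne, h0,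
      ENNReal.add_right_inj ENNReal.ofReal_ne_top, mul_eq_zero] at hr₀
    exact hr₀.elim (ENNReal.inv_ne_zero.2 ((wNorm_lt_top_iff hp0 _).1 hX₀.fin_u).ne) hG₀
  have hGw : wInt θ (fun r => higherPart p μ |w r|) ≠ 0 :=
    fun h => hv₀ (le_zero_iff.1 ((hmax _ _ hA₀).trans h.le))
  have hN1 : wInt θ (fun r => |w r| ^ p) ≤ 1 := (wInt_le_iff hθ _).2 hw.mass
  have hN0 : wInt θ (fun r => |w r| ^ p) ≠ 0 := fun h =>
    hGw (wInt_higherPart_eq_zero hp1 hw.aemeasurable h hθ)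
  have hw0 : w ≠ 0 := by
    rintro rfl
    exact hGw (by simp [wInt, higherPart_zero hp1])
  obtain ⟨hwX, hwE⟩ := (adm_iff_memX hp1 hθ hN1).1 hw
  refine ⟨w, w', hwX, hw0, hwE, le_antisymm ?_ ?_⟩
  · have hle : ENNReal.ofReal (leadCoeff p μ) + wInt θ (fun r => higherPart p μ |w r|) ≤
        wNorm θ p w ^ (-p) * TMfunc p θ μ w := by
      rw [ratio_eq hp1 hμ hw.aemeasurable hN0 (hN1.trans_lt ENNReal.one_lt_top).ne]
      gcongr
      exact le_mul_of_one_le_left' (ENNReal.one_le_inv.2 hN1)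
    refine iSup_le fun u => iSup_le fun u' => iSup_le fun hX => iSup_le fun _ => iSup_le fun hE => ?_
    by_cases hN : wInt θ (fun r => |u r| ^ p) = 0
    · rw [TMfunc_eq hp1 hμ (hX.aemeasurable hp1 hθ), hN,
        wInt_higherPart_eq_zero hp1 (hX.aemeasurable hp1 hθ) hN hθ]
      simp
    · obtain ⟨v, v', hv, hr⟩ := exists_normalized hp1 hθ hμ hX hE hN
      rw [hr]
      exact (add_le_add le_rfl (hmax v v' hv)).trans hle
  · exact le_iSup_of_le w (le_iSup_of_le w' (le_iSup_of_le hwX (le_iSup_of_le hw0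
      (le_iSup_of_le hwE le_rfl))))
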